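/- arXiv:2311.14257 — 4 statements merged into one kernel-verified Lean document; each statement's English description precedes it below -/
import Mathlib

section
/- Let M be an atomless von Neumann algebra on a complex Hilbert space H and let (x_n)_{n∈ℕ} be a sequence in M. Then there exist a nonempty upward-directed partially ordered set J and a family (p_j)_{j∈J} of projections of M such that: (i) the family is decreasing, i.e. j ≤ j′ implies p_{j′} ≤ p_j; (ii) its infimum in the projection lattice of M is 0, i.e. the only projection r of M with r ≤ p_j for all j ∈ J is r = 0; and (iii) ‖x_n ∘ p_j‖ = ‖x_n‖ for every n ∈ ℕ and every j ∈ J. -/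
noncomputable section

variable {H : Type*} [NormedAddCommGroup H] [InnerProductSpace ℂ H] [CompleteSpace H]

/-- `p` is a projection of the von Neumann algebra `M` : `p ∈ M`, `p = p*`, `p ∘ p = p`. -/
def IsProjectionIn (M : VonNeumannAlgebra H) (p : H →L[ℂ] H) : Prop :=
  p ∈ M ∧ star p = p ∧ p * p = p

/-- `p` is a minimal projection of `M`: `p` is a nonzero projection of `M` and the only
projections `q` of `M` with `q ≤ p` (i.e. `p ∘ q = q`) are `0` and `p`. -/
def IsMinimalProjectionIn (M : VonNeumannAlgebra H) (p : H →L[ℂ] H) : Prop :=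
  IsProjectionIn M p ∧ p ≠ 0 ∧
    ∀ q, IsProjectionIn M q → p * q = q → q = 0 ∨ q = p

/-- `M` is atomless if it has no minimal projections. -/
def VonNeumannAlgebra.Atomless (M : VonNeumannAlgebra H) : Prop :=
  ∀ p : H →L[ℂ] H, ¬ IsMinimalProjectionIn M p

/-- closed subspace invariant under the commutant of `M`. -/
def AffSub (M : VonNeumannAlgebra H) (K : Submodule ℂ H) : Prop :=
  IsClosed (K : Set H) ∧ ∀ y ∈ M.commutant, ∀ v ∈ K, y v ∈ K

theorem AffSub.hasProj {M : VonNeumannAlgebra H} {K : Submodule ℂ H} (h : AffSub M K) :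
    K.HasOrthogonalProjection := by
  have : CompleteSpace K := h.1.completeSpace_coe
  infer_instance

theorem comm_apply {M : VonNeumannAlgebra H} {T y : H →L[ℂ] H} (hT : T ∈ M)
    (hy : y ∈ M.commutant) (v : H) : y (T v) = T (y v) := by
  have := VonNeumannAlgebra.mem_commutant_iff.1 hy T hT
  exact (congrArg (fun S : H →L[ℂ] H => S v) this).symm

theorem AffSub.orth {M : VonNeumannAlgebra H} {K : Submodule ℂ H} (h : AffSub M K) :
    AffSub M Kᗮ := by
  refine ⟨K.isClosed_orthogonal, fun y hy v hv => ?_⟩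
  rw [Submodule.mem_orthogonal] at hv ⊢
  intro u hu
  have := hv _ (h.2 _ (star_mem hy) u hu)
  rw [ContinuousLinearMap.star_eq_adjoint, ContinuousLinearMap.adjoint_inner_left] at this
  exact this

theorem AffSub.inf {M : VonNeumannAlgebra H} {K K' : Submodule ℂ H} (h : AffSub M K)
    (h' : AffSub M K') : AffSub M (K ⊓ K') :=
  ⟨h.1.inter h'.1, fun y hy v hv => ⟨h.2 y hy v hv.1, h'.2 y hy v hv.2⟩⟩

theorem AffSub.iInf {M : VonNeumannAlgebra H} {K : ℕ → Submodule ℂ H}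
    (h : ∀ i, AffSub M (K i)) : AffSub M (⨅ i, K i) := by
  refine ⟨?_, fun y hy v hv => ?_⟩
  · rw [Submodule.coe_iInf]
    exact isClosed_iInter fun i => (h i).1
  · rw [Submodule.mem_iInf] at hv ⊢
    exact fun i => (h i).2 y hy v (hv i)

theorem affSub_closure {M : VonNeumannAlgebra H} {K : Submodule ℂ H}
    (h : ∀ y ∈ M.commutant, ∀ v ∈ K, y v ∈ K) : AffSub M K.topologicalClosure := by
  refine ⟨K.isClosed_topologicalClosure, fun y hy v hv => ?_⟩
  exact map_mem_closure y.continuous hv (fun w hw => h y hy w hw)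

theorem inv_map {M : VonNeumannAlgebra H} {K : Submodule ℂ H} (h : AffSub M K)
    {T : H →L[ℂ] H} (hT : T ∈ M) :
    ∀ y ∈ M.commutant, ∀ v ∈ K.map (T : H →ₗ[ℂ] H), y v ∈ K.map (T : H →ₗ[ℂ] H) := by
  rintro y hy _ ⟨w, hw, rfl⟩
  exact ⟨y w, h.2 y hy w hw, (comm_apply hT hy w).symm⟩

theorem affSub_top (M : VonNeumannAlgebra H) : AffSub M ⊤ :=
  ⟨by simp, fun _ _ _ _ => trivial⟩

theorem affSub_bot (M : VonNeumannAlgebra H) : AffSub M ⊥ :=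
  ⟨by simp, fun y _ v hv => by simp_all⟩

theorem AffSub.proj_mem {M : VonNeumannAlgebra H} {K : Submodule ℂ H} (h : AffSub M K)
    [K.HasOrthogonalProjection] : K.starProjection ∈ M := by
  rw [VonNeumannAlgebra.IsStarProjection.mem_iff isStarProjection_starProjection]
  intro y hy
  rw [Submodule.range_starProjection]
  exact fun v hv => h.2 y hy v hv

theorem AffSub.isProjectionIn {M : VonNeumannAlgebra H} {K : Submodule ℂ H} (h : AffSub M K)
    [K.HasOrthogonalProjection] : IsProjectionIn M K.starProjection :=
  ⟨h.proj_mem, isStarProjection_starProjection.isSelfAdjoint,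
    isStarProjection_starProjection.isIdempotentElem⟩

theorem IsProjectionIn.affSub {M : VonNeumannAlgebra H} {p : H →L[ℂ] H}
    (h : IsProjectionIn M p) : AffSub M (p : H →ₗ[ℂ] H).range := by
  refine ⟨?_, ?_⟩
  · have : ((p : H →ₗ[ℂ] H).range : Set H) = {v | p v = v} := by
      ext v
      constructor
      · rintro ⟨w, rfl⟩
        exact congrArg (fun S : H →L[ℂ] H => S w) h.2.2
      · intro hv
        exact ⟨v, hv⟩
    rw [this]
    exact isClosed_eq p.continuous continuous_id
  · rintro y hy _ ⟨w, rfl⟩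
    exact ⟨y w, (comm_apply h.1 hy w).symm⟩

/-- atomless: proper nonzero subspaces. -/
theorem exists_proper {M : VonNeumannAlgebra H} (hM : M.Atomless) {K : Submodule ℂ H}
    (h : AffSub M K) (h0 : K ≠ ⊥) : ∃ K', AffSub M K' ∧ K' ≤ K ∧ K' ≠ ⊥ ∧ K' ≠ K := by
  have := h.hasProj
  by_contra! hcon
  apply hM K.starProjection
  refine ⟨h.isProjectionIn, ?_, ?_⟩
  · intro h1
    apply h0
    rw [← Submodule.range_starProjection K, h1]
    simp
  · intro q hq hpq
    have hle : (q : H →ₗ[ℂ] H).range ≤ K := by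
      rintro _ ⟨w, rfl⟩
      have := congrArg (fun S : H →L[ℂ] H => S w) hpq
      exact Submodule.starProjection_eq_self_iff.1 this
    by_cases hb : (q : H →ₗ[ℂ] H).range = ⊥
    · left
      ext v
      have : q v ∈ (q : H →ₗ[ℂ] H).range := ⟨v, rfl⟩
      rw [hb] at this
      simpa using this
    · right
      have hK := hcon _ hq.affSub hle hb
      have h2 : q * K.starProjection = K.starProjection := by
        ext v
        have : K.starProjection v ∈ (q : H →ₗ[ℂ] H).range := by
          rw [hK]; exact Submodule.starProjection_apply_mem _ _
        obtain ⟨w, hw⟩ := this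
        change q (K.starProjection v) = K.starProjection v
        rw [← hw]
        exact congrArg (fun S : H →L[ℂ] H => S w) hq.2.2
      have h3 := congrArg star h2
      rw [star_mul, hq.2.1, h.isProjectionIn.2.1, hpq] at h3
      exact h3

/-- halving. -/
theorem exists_half {M : VonNeumannAlgebra H} (hM : M.Atomless) {K : Submodule ℂ H}
    (h : AffSub M K) (h0 : K ≠ ⊥) (ξ : H) (n : ℕ) :
    ∃ K', AffSub M K' ∧ K' ≤ K ∧ K' ≠ ⊥ ∧
      ∃ u ∈ K', ξ - u ∈ K'ᗮ ∧ ‖u‖ ^ 2 ≤ ‖ξ‖ ^ 2 / 2 ^ n := by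
  induction n with
  | zero =>
    have := h.hasProj
    refine ⟨K, h, le_rfl, h0, K.starProjection ξ, Submodule.starProjection_apply_mem _ _,
      Submodule.sub_starProjection_mem_orthogonal _, ?_⟩
    have := Submodule.norm_sq_eq_add_norm_sq_starProjection ξ K
    simp only [pow_zero, div_one]
    nlinarith [sq_nonneg ‖Kᗮ.starProjection ξ‖]
  | succ n ih =>
    obtain ⟨K1, h1, hle, hne, u, hu, huo, hn⟩ := ih
    obtain ⟨K2, h2, hle2, hne2, hne2'⟩ := exists_proper hM h1 hne
    have := h2.hasProj
    have h3 : AffSub M (K2ᗮ ⊓ K1) := h2.orth.inf h1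
    have hne3 : K2ᗮ ⊓ K1 ≠ ⊥ := by
      intro hb
      have := Submodule.sup_orthogonal_inf_of_hasOrthogonalProjection hle2
      rw [hb, sup_bot_eq] at this
      exact hne2' this
    set a := K2.starProjection u with ha
    have ha2 : a ∈ K2 := Submodule.starProjection_apply_mem _ _
    have hb2 : u - a ∈ K2ᗮ := Submodule.sub_starProjection_mem_orthogonal _
    have hs : ‖u‖ ^ 2 = ‖a‖ ^ 2 + ‖u - a‖ ^ 2 := by
      have h4 : inner ℂ a (u - a) = 0 := Submodule.inner_right_of_mem_orthogonal ha2 hb2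
      have := norm_add_sq_eq_norm_sq_add_norm_sq_of_inner_eq_zero a (u - a) h4
      rw [add_sub_cancel] at this
      nlinarith
    have hp : ‖ξ‖ ^ 2 / 2 ^ (n + 1) = ‖ξ‖ ^ 2 / 2 ^ n / 2 := by
      rw [pow_succ (2 : ℝ) n, div_div]
    by_cases hc : ‖a‖ ^ 2 ≤ ‖u‖ ^ 2 / 2
    · refine ⟨K2, h2, hle2.trans hle, hne2, a, ha2, ?_, by rw [hp]; linarith⟩
      have : ξ - a = (ξ - u) + (u - a) := by abel
      rw [this]
      exact add_mem (Submodule.orthogonal_le hle2 huo) hb2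
    · refine ⟨_, h3, inf_le_right.trans hle, hne3, u - a, ⟨hb2, sub_mem hu (hle2 ha2)⟩, ?_,
        by rw [hp]; linarith⟩
      have : ξ - (u - a) = (ξ - u) + a := by abel
      rw [this]
      refine add_mem (Submodule.orthogonal_le inf_le_right huo) ?_
      exact Submodule.orthogonal_le inf_le_left (Submodule.le_orthogonal_orthogonal _ ha2)

theorem exists_small {M : VonNeumannAlgebra H} (hM : M.Atomless) {K : Submodule ℂ H}
    (h : AffSub M K) (h0 : K ≠ ⊥) (ξ : H) {ε : ℝ} (hε : 0 < ε) :
    ∃ K', AffSub M K' ∧ K' ≤ K ∧ K' ≠ ⊥ ∧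
      ∃ u ∈ K', ξ - u ∈ K'ᗮ ∧ ‖u‖ ≤ ε := by
  obtain ⟨n, hn⟩ := pow_unbounded_of_one_lt (‖ξ‖ ^ 2 / ε ^ 2) (one_lt_two : (1 : ℝ) < 2)
  obtain ⟨K', h1, h2, h3, u, hu, huo, hb⟩ := exists_half hM h h0 ξ n
  refine ⟨K', h1, h2, h3, u, hu, huo, ?_⟩
  refine le_of_sq_le_sq ?_ hε.le
  refine hb.trans ?_
  rw [div_lt_iff₀ (by positivity)] at hn
  rw [div_le_iff₀ (by positivity)]
  linarith

/-- spectral subspaces. -/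
theorem exists_spectral {M : VonNeumannAlgebra H} {x : H →L[ℂ] H} (hx : x ∈ M) {c : ℝ}
    (v₀ : H) (hv₀ : c ^ 2 * ‖v₀‖ ^ 2 < ‖x v₀‖ ^ 2) :
    ∃ e, AffSub M e ∧ e ≠ ⊥ ∧ ∀ w ∈ e, c ^ 2 * ‖w‖ ^ 2 ≤ ‖x w‖ ^ 2 := by
  set d : H →L[ℂ] H := star x * x - ((c ^ 2 : ℝ) : ℂ) • 1 with hd
  have hinner : ∀ w, (inner ℂ (d w) w).re = ‖x w‖ ^ 2 - c ^ 2 * ‖w‖ ^ 2 := by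
    intro w
    have : d w = ContinuousLinearMap.adjoint x (x w) - ((c ^ 2 : ℝ) : ℂ) • w := rfl
    rw [this, inner_sub_left, ContinuousLinearMap.adjoint_inner_left, inner_smul_left,
      inner_self_eq_norm_sq_to_K, inner_self_eq_norm_sq_to_K, Complex.conj_ofReal]
    norm_cast
    change (((‖x w‖ ^ 2 : ℝ) : ℂ) - ((c ^ 2 : ℝ) : ℂ) * ((‖w‖ ^ 2 : ℝ) : ℂ)).re = _
    rw [← Complex.ofReal_mul, ← Complex.ofReal_sub, Complex.ofReal_re]
  have hdsa : IsSelfAdjoint d := by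
    rw [hd]
    refine (IsSelfAdjoint.star_mul_self x).sub ?_
    refine IsSelfAdjoint.smul ?_ (IsSelfAdjoint.one _)
    exact Complex.conj_ofReal _
  have hdec : d⁺ - d⁻ = d := CFC.posPart_sub_negPart d hdsa
  have hpos : ∀ w, 0 ≤ (inner ℂ (d⁺ w) w).re := fun w =>
    ((ContinuousLinearMap.nonneg_iff_isPositive _).1 (CFC.posPart_nonneg d)).re_inner_nonneg_left w
  have hneg : ∀ w, 0 ≤ (inner ℂ (d⁻ w) w).re := fun w =>
    ((ContinuousLinearMap.nonneg_iff_isPositive _).1 (CFC.negPart_nonneg d)).re_inner_nonneg_left w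
  have hsplit : ∀ w, (inner ℂ (d w) w).re = (inner ℂ (d⁺ w) w).re - (inner ℂ (d⁻ w) w).re := by
    intro w
    conv_lhs => rw [← hdec]
    simp
  refine ⟨(d⁻ : H →L[ℂ] H).ker, ⟨ContinuousLinearMap.isClosed_ker _, ?_⟩, ?_, ?_⟩
  · intro y hy v hv
    have hdy : Commute d y := by
      have h1 := VonNeumannAlgebra.mem_commutant_iff.1 hy x hx
      have h2 := VonNeumannAlgebra.mem_commutant_iff.1 hy _ (star_mem hx)
      rw [hd]
      refine Commute.sub_left (Commute.mul_left h2 h1) ?_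
      exact (Commute.one_left y).smul_left _
    have : Commute (d⁻) y := Commute.cfcₙ_real hdy _
    have h3 := congrArg (fun S : H →L[ℂ] H => S v) this.eq
    change d⁻ (y v) = y (d⁻ v) at h3
    have hv' : d⁻ v = 0 := hv
    change d⁻ (y v) = 0
    rw [h3, hv', map_zero]
  · intro hb
    have : d⁺ v₀ = 0 := by
      have h1 := congrArg (fun S : H →L[ℂ] H => S v₀) (CFC.negPart_mul_posPart d)
      have h2 : d⁺ v₀ ∈ (d⁻ : H →L[ℂ] H).ker := h1
      rw [hb] at h2
      simpa using h2
    have h1 := hsplit v₀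
    rw [this, hinner] at h1
    simp only [inner_zero_left, Complex.zero_re] at h1
    linarith [hneg v₀]
  · intro w hw
    have hw' : d⁻ w = 0 := hw
    have h1 := hsplit w
    rw [hw', hinner] at h1
    simp only [inner_zero_left, Complex.zero_re] at h1
    linarith [hpos w]

theorem exists_spectral_le {M : VonNeumannAlgebra H} {x : H →L[ℂ] H} (hx : x ∈ M) {c : ℝ}
    (hc : 0 < c) {q : Submodule ℂ H} (hq : AffSub M q)
    (v₀ : H) (hv : v₀ ∈ q) (hv₀ : c * ‖v₀‖ < ‖x v₀‖) :
    ∃ e, AffSub M e ∧ e ≤ q ∧ e ≠ ⊥ ∧ ∀ w ∈ e, c * ‖w‖ ≤ ‖x w‖ := by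
  have := hq.hasProj
  have hP := hq.proj_mem
  obtain ⟨e, he, hne, hb⟩ := exists_spectral (mul_mem hx hP) (c := c) v₀ (by
    change _ < ‖x (q.starProjection v₀)‖ ^ 2
    rw [Submodule.starProjection_eq_self_iff.2 hv, ← mul_pow]
    exact pow_lt_pow_left₀ hv₀ (by positivity) two_ne_zero)
  have hb' : ∀ w ∈ e, c * ‖w‖ ≤ ‖x (q.starProjection w)‖ := fun w hw => by
    have := hb w hw
    rw [← mul_pow] at this
    exact le_of_sq_le_sq this (norm_nonneg _)
  refine ⟨_, affSub_closure (inv_map he hP), ?_, ?_, ?_⟩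
  · refine Submodule.topologicalClosure_minimal _ ?_ hq.1
    rintro _ ⟨w, _, rfl⟩
    exact Submodule.starProjection_apply_mem _ _
  · obtain ⟨w, hw, hw0⟩ := Submodule.exists_mem_ne_zero_of_ne_bot hne
    intro hbot
    have h1 : q.starProjection w ∈ (e.map (q.starProjection : H →ₗ[ℂ] H)).topologicalClosure :=
      Submodule.le_topologicalClosure _ ⟨w, hw, rfl⟩
    rw [hbot] at h1
    have h2 := hb' w hw
    rw [(Submodule.mem_bot ℂ).1 h1, map_zero, norm_zero] at h2
    have : 0 < ‖w‖ := norm_pos_iff.2 hw0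
    nlinarith
  · have hcl : IsClosed {w : H | c * ‖w‖ ≤ ‖x w‖} :=
      isClosed_le (by fun_prop) (by fun_prop)
    intro w hw
    refine closure_minimal ?_ hcl hw
    rintro _ ⟨v, hv, rfl⟩
    refine le_trans ?_ (hb' v hv)
    gcongr
    exact Submodule.norm_starProjection_apply_le q v

theorem step_removal {M : VonNeumannAlgebra H} (hM : M.Atomless) {q f e : Submodule ℂ H}
    (hf : AffSub M f) (he : AffSub M e) (hfq : f ≤ q) (heq : e ≤ q)
    (hne : e ≠ ⊥) {x : H →L[ℂ] H} {c c' : ℝ} (hc : 0 ≤ c) (hcc : c < c')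
    (hb : ∀ w ∈ e, c' * ‖w‖ ≤ ‖x w‖) {η : H} (hη : η ∈ f) {ε : ℝ} (hε : 0 < ε) :
    ∃ f' η', AffSub M f' ∧ f' ≤ f ∧ η' ∈ f' ∧ ‖η - η'‖ ≤ ε ∧
      ∃ v ∈ q ⊓ f'ᗮ, c * ‖v‖ < ‖x v‖ := by
  have := hf.hasProj
  set δ : ℝ := (c' - c) / (‖x‖ + 1) with hδ
  have hx1 : 0 < ‖x‖ + 1 := by positivity
  have hδ0 : 0 < δ := div_pos (sub_pos.2 hcc) hx1
  by_cases hcase : ∃ v ∈ e, ‖f.starProjection v‖ < δ * ‖v‖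
  · obtain ⟨v, hv, hlt⟩ := hcase
    refine ⟨f, η, hf, le_rfl, hη, by simpa using hε.le, v - f.starProjection v, ⟨?_, ?_⟩, ?_⟩
    · exact sub_mem (heq hv) (hfq (Submodule.starProjection_apply_mem _ _))
    · exact Submodule.sub_starProjection_mem_orthogonal _
    · have hv0 : 0 < ‖v‖ := by
        by_contra h
        have h0 : ‖v‖ = 0 := le_antisymm (not_lt.1 h) (norm_nonneg _)
        rw [h0, mul_zero] at hlt
        exact absurd hlt (not_lt.2 (norm_nonneg _))
      have h1 : ‖v - f.starProjection v‖ ≤ ‖v‖ := by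
        have h2 := Submodule.norm_starProjection_apply_le fᗮ v
        rwa [Submodule.starProjection_orthogonal_val] at h2
      have h3 : ‖x v‖ - ‖x (f.starProjection v)‖ ≤ ‖x (v - f.starProjection v)‖ := by
        rw [map_sub]
        exact norm_sub_norm_le _ _
      have h4 : ‖x (f.starProjection v)‖ ≤ ‖x‖ * ‖f.starProjection v‖ := x.le_opNorm _
      have h5 : ‖x‖ * ‖f.starProjection v‖ < (c' - c) * ‖v‖ := by
        calc ‖x‖ * ‖f.starProjection v‖ ≤ (‖x‖ + 1) * ‖f.starProjection v‖ := by
              gcongr; linarith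
          _ < (‖x‖ + 1) * (δ * ‖v‖) := by gcongr
          _ = (c' - c) * ‖v‖ := by rw [hδ]; field_simp
      have h6 := hb v hv
      have h7 : c * ‖v - f.starProjection v‖ ≤ c * ‖v‖ := by gcongr
      linarith
  · push Not at hcase
    set T : Submodule ℂ H := e.map (f.starProjection : H →ₗ[ℂ] H) with hT
    have hTclosed : IsClosed (T : Set H) := by
      have hcomp : CompleteSpace e := he.1.completeSpace_coe
      let S : e →L[ℂ] H := f.starProjection.comp e.subtypeL
      have hS : AntilipschitzWith (⟨δ⁻¹, by positivity⟩ : NNReal) S := by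
        refine AddMonoidHomClass.antilipschitz_of_bound S fun w => ?_
        have := hcase w.1 w.2
        change ‖(w : H)‖ ≤ δ⁻¹ * ‖f.starProjection w‖
        rw [inv_mul_eq_div, le_div_iff₀ hδ0]
        linarith
      have h1 := hS.isClosed_range S.uniformContinuous
      have h2 : (T : Set H) = Set.range S := by
        ext v
        constructor
        · rintro ⟨w, hw, rfl⟩
          exact ⟨⟨w, hw⟩, rfl⟩
        · rintro ⟨w, rfl⟩
          exact ⟨w.1, w.2, rfl⟩
      rw [h2]
      exact h1
    have hTaff : AffSub M T := ⟨hTclosed, inv_map he hf.proj_mem⟩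
    have hTf : T ≤ f := by
      rintro _ ⟨w, _, rfl⟩
      exact Submodule.starProjection_apply_mem _ _
    have hT0 : T ≠ ⊥ := by
      obtain ⟨w, hw, hw0⟩ := Submodule.exists_mem_ne_zero_of_ne_bot hne
      intro hbot
      have h1 : f.starProjection w ∈ T := ⟨w, hw, rfl⟩
      rw [hbot] at h1
      have h2 := hcase w hw
      rw [(Submodule.mem_bot ℂ).1 h1, norm_zero] at h2
      have : 0 < ‖w‖ := norm_pos_iff.2 hw0
      nlinarith
    obtain ⟨h, hh, hhT, hh0, u, hu, huo, hun⟩ := exists_small hM hTaff hT0 η hε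
    refine ⟨f ⊓ hᗮ, η - u, hf.inf hh.orth, inf_le_left, ⟨sub_mem hη (hTf (hhT hu)), huo⟩,
      by simpa using hun, ?_⟩
    obtain ⟨z, hz, hz0⟩ := Submodule.exists_mem_ne_zero_of_ne_bot hh0
    obtain ⟨v, hv, hvz⟩ := hhT hz
    change f.starProjection v = z at hvz
    have hv0 : v ≠ 0 := by
      rintro rfl
      rw [map_zero] at hvz
      exact hz0 hvz.symm
    refine ⟨v, ⟨heq hv, ?_⟩, ?_⟩
    · have h1 : v = (v - f.starProjection v) + z := by rw [hvz]; abel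
      rw [h1]
      refine add_mem (Submodule.orthogonal_le inf_le_left
        (Submodule.sub_starProjection_mem_orthogonal _)) ?_
      exact Submodule.orthogonal_le inf_le_right (Submodule.le_orthogonal_orthogonal _ hz)
    · refine lt_of_lt_of_le ?_ (hb v hv)
      have : 0 < ‖v‖ := norm_pos_iff.2 hv0
      gcongr

/-- thresholds -/
def thr (x : ℕ → (H →L[ℂ] H)) (n k : ℕ) : ℝ := ‖x n‖ * (1 - 1 / ((k : ℝ) + 2))

/-- `K` almost norms `x n` up to level `k`. -/
def Gd (x : ℕ → (H →L[ℂ] H)) (K : Submodule ℂ H) (n k : ℕ) : Prop :=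
  0 < ‖x n‖ → ∃ v ∈ K, thr x n k * ‖v‖ < ‖x n v‖

theorem Gd.mono {x : ℕ → (H →L[ℂ] H)} {K K' : Submodule ℂ H} {n k : ℕ} (h : Gd x K n k)
    (hle : K ≤ K') : Gd x K' n k := fun h0 => by
  obtain ⟨v, hv, h1⟩ := h h0
  exact ⟨v, hle hv, h1⟩

theorem thr_pos {x : ℕ → (H →L[ℂ] H)} {n : ℕ} (k : ℕ) (h : 0 < ‖x n‖) : 0 < thr x n k := by
  refine mul_pos h (sub_pos.2 ?_)
  rw [div_lt_one (by positivity)]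
  have : (0 : ℝ) ≤ k := by positivity
  linarith

theorem thr_lt {x : ℕ → (H →L[ℂ] H)} {n : ℕ} (k : ℕ) (h : 0 < ‖x n‖) :
    thr x n k < thr x n (k + 1) := by
  unfold thr
  have : 1 / (((k + 1 : ℕ) : ℝ) + 2) < 1 / ((k : ℝ) + 2) := by
    apply one_div_lt_one_div_of_lt (by positivity)
    push_cast
    linarith
  gcongr

theorem thr_lt_norm {x : ℕ → (H →L[ℂ] H)} {n : ℕ} (k : ℕ) (h : 0 < ‖x n‖) :
    thr x n k < ‖x n‖ := by
  unfold thr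
  have : 0 < 1 / ((k : ℝ) + 2) := by positivity
  nlinarith

theorem key_split {M : VonNeumannAlgebra H} (hM : M.Atomless) {x : ℕ → (H →L[ℂ] H)}
    (hx : ∀ n, x n ∈ M) {q : Submodule ℂ H} (hq : AffSub M q) (hN : ∀ n k, Gd x q n k)
    (n₀ k₀ : ℕ) :
    ∃ f, AffSub M f ∧ f ≤ q ∧ Gd x f n₀ k₀ ∧ ∀ n k, Gd x (q ⊓ fᗮ) n k := by
  rcases (norm_nonneg (x n₀)).eq_or_lt with h0 | h0
  · refine ⟨⊥, affSub_bot M, bot_le, fun h => absurd h (by rw [← h0]; exact lt_irrefl _), ?_⟩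
    simpa using hN
  have hspec : ∀ n k, 0 < ‖x n‖ → ∃ e, AffSub M e ∧ e ≤ q ∧ e ≠ ⊥ ∧
      ∀ w ∈ e, thr x n (k + 1) * ‖w‖ ≤ ‖x n w‖ := by
    intro n k hn
    obtain ⟨v, hv, hv1⟩ := hN n (k + 1) hn
    exact exists_spectral_le (hx n) (thr_pos _ hn) hq v hv hv1
  obtain ⟨e₀, he₀, he₀q, he₀0, he₀b⟩ := hspec n₀ k₀ h0
  obtain ⟨ξ, hξ, hξ0⟩ := Submodule.exists_mem_ne_zero_of_ne_bot he₀0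
  have hξ0' : 0 < ‖ξ‖ := norm_pos_iff.2 hξ0
  let S := {p : Submodule ℂ H × H // AffSub M p.1 ∧ p.1 ≤ q ∧ p.2 ∈ p.1}
  have hstep : ∀ (i : ℕ) (s : S), ∃ s' : S, s'.1.1 ≤ s.1.1 ∧
      ‖s.1.2 - s'.1.2‖ ≤ ‖ξ‖ / 2 / 2 / 2 ^ i ∧
      Gd x (q ⊓ s'.1.1ᗮ) i.unpair.1 i.unpair.2 := by
    rintro i ⟨⟨f, η⟩, hf, hfq, hη⟩
    rcases (norm_nonneg (x i.unpair.1)).eq_or_lt with h1 | h1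
    · refine ⟨⟨⟨f, η⟩, hf, hfq, hη⟩, le_rfl, ?_, fun h => absurd h (by rw [← h1]; exact lt_irrefl _)⟩
      simp only [sub_self, norm_zero]
      positivity
    · obtain ⟨e, he, heq, hne, hb⟩ := hspec i.unpair.1 i.unpair.2 h1
      obtain ⟨f', η', hf', hle, hη', hn, hv⟩ := step_removal hM hf he hfq heq hne
        (thr_pos _ h1).le (thr_lt _ h1) hb hη (ε := ‖ξ‖ / 2 / 2 / 2 ^ i) (by positivity)
      exact ⟨⟨⟨f', η'⟩, hf', hle.trans hfq, hη'⟩, hle, hn, fun _ => hv⟩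
  choose g hg1 hg2 hg3 using hstep
  let s : ℕ → S := fun i => Nat.rec ⟨⟨e₀, ξ⟩, he₀, he₀q, hξ⟩ (fun i s => g i s) i
  have hs1 : ∀ i, (s (i + 1)).1.1 ≤ (s i).1.1 := fun i => hg1 i (s i)
  have hs2 : ∀ i, dist (s i).1.2 (s (i + 1)).1.2 ≤ ‖ξ‖ / 2 / 2 / 2 ^ i := fun i => by
    rw [dist_eq_norm]; exact hg2 i (s i)
  have hs3 : ∀ i, Gd x (q ⊓ (s (i + 1)).1.1ᗮ) i.unpair.1 i.unpair.2 := fun i => hg3 i (s i)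
  have hanti : Antitone fun i => (s i).1.1 := antitone_nat_of_succ_le hs1
  obtain ⟨z, hz⟩ := cauchySeq_tendsto_of_complete (cauchySeq_of_le_geometric_two hs2)
  have hdist : dist ξ z ≤ ‖ξ‖ / 2 := dist_le_of_le_geometric_two_of_tendsto₀ hs2 hz
  have hz0 : z ≠ 0 := by
    rintro rfl
    rw [dist_zero_right] at hdist
    linarith
  have hzmem : z ∈ ⨅ i, (s i).1.1 := by
    rw [Submodule.mem_iInf]
    intro i
    refine (s i).2.1.1.mem_of_tendsto hz ?_
    filter_upwards [Filter.eventually_ge_atTop i] with j hj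
    exact hanti hj (s j).2.2.2
  refine ⟨⨅ i, (s i).1.1, AffSub.iInf fun i => (s i).2.1, (iInf_le _ 0).trans he₀q, ?_, ?_⟩
  · intro _
    refine ⟨z, hzmem, ?_⟩
    have h1 : z ∈ e₀ := (Submodule.mem_iInf _).1 hzmem 0
    refine lt_of_lt_of_le ?_ (he₀b z h1)
    have : 0 < ‖z‖ := norm_pos_iff.2 hz0
    have := thr_lt k₀ h0
    gcongr
  · intro n k
    have h1 := hs3 (Nat.pair n k)
    rw [Nat.unpair_pair] at h1
    exact h1.mono (inf_le_inf_left _ (Submodule.orthogonal_le (iInf_le (fun i => (s i).1.1) (Nat.pair n k + 1))))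

/-- **Lemma 3.3.** If `M` is an atomless von Neumann algebra and
`(x_n)` is a sequence in `M`, then there is a nonempty upward-directed partially
ordered set `J` and a decreasing net `(p_j)_{j ∈ J}` of projections of `M` with
infimum `0` in the projection lattice such that `‖x_n ∘ p_j‖ = ‖x_n‖` for all
`n` and `j`. -/
theorem exists_net_of_projections_atomless (M : VonNeumannAlgebra H)
    (hM : M.Atomless) (x : ℕ → (H →L[ℂ] H)) (hx : ∀ n, x n ∈ M) :
    ∃ (J : Type) (le : J → J → Prop), Nonempty J ∧ IsPartialOrder J le ∧
      (∀ j j' : J, ∃ k : J, le j k ∧ le j' k) ∧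
      ∃ p : J → (H →L[ℂ] H),
        (∀ j, IsProjectionIn M (p j)) ∧
        -- decreasing: `j ≤ j'` implies `p j' ≤ p j`, i.e. `p j ∘ p j' = p j'`
        (∀ j j', le j j' → p j * p j' = p j') ∧
        -- infimum `0`: the only projection `r` of `M` below every `p j` is `0`
        (∀ r, IsProjectionIn M r → (∀ j, p j * r = r) → r = 0) ∧
        (∀ n j, ‖x n * p j‖ = ‖x n‖) := by
  have hN0 : ∀ n k, Gd x (⊤ : Submodule ℂ H) n k := by
    intro n k hn
    by_contra! hcon
    have := (x n).opNorm_le_bound (thr_pos k hn).le fun v => hcon v trivial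
    exact absurd this (not_le.2 (thr_lt_norm k hn))
  let S := {q : Submodule ℂ H // AffSub M q ∧ ∀ n k, Gd x q n k}
  have hstep : ∀ (i : ℕ) (q : S), ∃ f : Submodule ℂ H, AffSub M f ∧ f ≤ q.1 ∧
      Gd x f i.unpair.1 i.unpair.2 ∧ ∀ n k, Gd x (q.1 ⊓ fᗮ) n k :=
    fun i q => key_split hM hx q.2.1 q.2.2 _ _
  choose F hF1 hF2 hF3 hF4 using hstep
  let q : ℕ → S := fun i => Nat.rec ⟨⊤, affSub_top M, hN0⟩
    (fun i q => ⟨q.1 ⊓ (F i q)ᗮ, q.2.1.inf (hF1 i q).orth, hF4 i q⟩) i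
  let f : ℕ → Submodule ℂ H := fun i => F i (q i)
  have hf1 : ∀ i, AffSub M (f i) := fun i => hF1 i (q i)
  have hqs : ∀ i, (q (i + 1)).1 = (q i).1 ⊓ (f i)ᗮ := fun i => rfl
  have hanti : Antitone fun i => (q i).1 :=
    antitone_nat_of_succ_le fun i => by rw [hqs]; exact inf_le_left
  have hfq : ∀ i, f i ≤ (q i).1 := fun i => hF2 i (q i)
  let P : ℕ → Submodule ℂ H := fun m => (⨆ i : {i // m ≤ i}, f i).topologicalClosure
  have hP : ∀ m, AffSub M (P m) := by
    intro m
    apply affSub_closure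
    intro y hy
    have : (⨆ i : {i // m ≤ i}, f i) ≤
        (⨆ i : {i // m ≤ i}, f i).comap (y : H →ₗ[ℂ] H) := by
      refine iSup_le fun i v hv => ?_
      exact Submodule.mem_iSup_of_mem i ((hf1 i).2 y hy v hv)
    exact fun v hv => this hv
  have hfP : ∀ m i, m ≤ i → f i ≤ P m := fun m i hi =>
    (le_iSup (fun i : {i // m ≤ i} => f i) ⟨i, hi⟩).trans (Submodule.le_topologicalClosure _)
  have hPle : ∀ m (K : Submodule ℂ H), IsClosed (K : Set H) → (∀ i, m ≤ i → f i ≤ K) →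
      P m ≤ K := fun m K hK h =>
    Submodule.topologicalClosure_minimal _ (iSup_le fun i => h i.1 i.2) hK
  have hPanti : Antitone P := fun m m' hm =>
    hPle m' _ (hP m).1 fun i hi => hfP m i (hm.trans hi)
  have hinst : ∀ m, (P m).HasOrthogonalProjection := fun m => (hP m).hasProj
  refine ⟨ℕ, (· ≤ ·), ⟨0⟩, inferInstance, fun j j' => ⟨max j j', le_max_left _ _, le_max_right _ _⟩,
    fun m => (P m).starProjection, fun m => (hP m).isProjectionIn, ?_, ?_, ?_⟩
  · intro j j' hj
    ext v
    exact Submodule.starProjection_eq_self_iff.2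
      (hPanti hj (Submodule.starProjection_apply_mem _ _))
  · intro r hr hle
    ext v
    have hmem : ∀ m, r v ∈ P m := fun m =>
      Submodule.starProjection_eq_self_iff.1 (congrArg (fun S : H →L[ℂ] H => S v) (hle m))
    have hort : ∀ i, P (i + 1) ≤ (f i)ᗮ := fun i =>
      hPle _ _ (Submodule.isClosed_orthogonal _) fun j hj =>
        (hfq j).trans ((hanti hj).trans (by
          change (q (i + 1)).1 ≤ _
          rw [hqs]; exact inf_le_right))
    have h0 : P 0 ≤ (ℂ ∙ r v)ᗮ := hPle _ _ (Submodule.isClosed_orthogonal _) fun i _ w hw => by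
      rw [Submodule.mem_orthogonal_singleton_iff_inner_left]
      exact Submodule.inner_right_of_mem_orthogonal hw (hort i (hmem (i + 1)))
    have h1 := h0 (hmem 0)
    rw [Submodule.mem_orthogonal_singleton_iff_inner_left] at h1
    simpa using h1
  · intro n j
    have hup : ‖x n * (P j).starProjection‖ ≤ ‖x n‖ := by
      refine (norm_mul_le _ _).trans ?_
      exact mul_le_of_le_one_right (norm_nonneg _) (Submodule.starProjection_norm_le _)
    refine le_antisymm hup ?_
    rcases (norm_nonneg (x n)).eq_or_lt with h0 | h0
    · rw [← h0]; exact norm_nonneg _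
    have hk : ∀ k, j ≤ k → thr x n k ≤ ‖x n * (P j).starProjection‖ := by
      intro k hk
      have h1 := hF3 (Nat.pair n k) (q (Nat.pair n k))
      rw [Nat.unpair_pair] at h1
      obtain ⟨v, hv, hlt⟩ := h1 h0
      have hvP : v ∈ P j := hfP j _ (hk.trans (Nat.right_le_pair n k)) hv
      have h2 := (x n * (P j).starProjection).le_opNorm v
      have h3 : (x n * (P j).starProjection) v = x n v := by
        change x n ((P j).starProjection v) = _
        rw [Submodule.starProjection_eq_self_iff.2 hvP]
      rw [h3] at h2
      have hv0 : 0 ≤ ‖v‖ := norm_nonneg v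
      by_contra! hcon
      nlinarith
    have hlim : Filter.Tendsto (fun k : ℕ => thr x n k) Filter.atTop (nhds ‖x n‖) := by
      have h1 : Filter.Tendsto (fun k : ℕ => 1 / ((k : ℝ) + 2)) Filter.atTop (nhds 0) := by
        have := (tendsto_const_div_atTop_nhds_zero_nat (1 : ℝ)).comp (Filter.tendsto_add_atTop_nat 2)
        refine this.congr fun k => ?_
        simp
      have h2 := (h1.const_sub 1).const_mul ‖x n‖
      simpa [thr] using h2
    refine le_of_tendsto hlim ?_
    filter_upwards [Filter.eventually_ge_atTop j] with k hk'
    exact hk k hk'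
end
end

section
/- Let H be a nontrivial complex Hilbert space and let M be an atomless von Neumann algebra on H. Then for every sequence (y_n)_{n∈ℕ} in M and every ε > 0 there exists g ∈ M such that ‖g − y_n‖ > ‖y_n‖ + 1 − ε for all n ∈ ℕ. -/
noncomputable section

variable {H : Type*} [NormedAddCommGroup H] [InnerProductSpace ℂ H] [CompleteSpace H]

open Filter Topology

lemma proj_pyth {q : H →L[ℂ] H} (hs : star q = q) (hq : q * q = q) (u w : H) :
    ‖q u + (w - q w)‖ ^ 2 = ‖q u‖ ^ 2 + ‖w - q w‖ ^ 2 := by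
  have h0 : inner ℂ (q u) (w - q w) = 0 := by
    have : inner ℂ (q u) (w - q w) = inner ℂ u (q (w - q w)) := by
      rw [← ContinuousLinearMap.adjoint_inner_right q, ← ContinuousLinearMap.star_eq_adjoint, hs]
    rw [this, map_sub]
    have : q (q w) = q w := congrArg (fun T : H →L[ℂ] H => T w) hq
    rw [this, sub_self, inner_zero_right]
  have := norm_add_sq_eq_norm_sq_add_norm_sq_of_inner_eq_zero (𝕜 := ℂ) _ _ h0
  simpa [sq] using this

lemma proj_small (M : VonNeumannAlgebra H) (hM : M.Atomless) (F : Finset H)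
    (p : H →L[ℂ] H) (hp : IsProjectionIn M p) (hp0 : p ≠ 0) (n : ℕ) :
    ∃ q, IsProjectionIn M q ∧ q ≠ 0 ∧ p * q = q ∧
      ∑ x ∈ F, ‖q x‖ ^ 2 ≤ (∑ x ∈ F, ‖p x‖ ^ 2) / 2 ^ n := by
  induction n with
  | zero => exact ⟨p, hp, hp0, hp.2.2, by simp⟩
  | succ n ih =>
    obtain ⟨q, hq, hq0, hpq, hle⟩ := ih
    have h1 : ∃ r, IsProjectionIn M r ∧ q * r = r ∧ r ≠ 0 ∧ r ≠ q := by
      by_contra! hcon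
      exact hM q ⟨hq, hq0, fun r hr hqr => by
        by_cases h : r = 0
        · exact Or.inl h
        · exact Or.inr (hcon r hr hqr h)⟩
    obtain ⟨r, hr, hqr, hr0, hrq⟩ := h1
    have hrq' : r * q = r := by
      have := congrArg star hqr
      rwa [star_mul, hr.2.1, hq.2.1] at this
    have hsum : ∑ x ∈ F, ‖q x‖ ^ 2 = ∑ x ∈ F, ‖r x‖ ^ 2 + ∑ x ∈ F, ‖(q - r) x‖ ^ 2 := by
      rw [← Finset.sum_add_distrib]
      refine Finset.sum_congr rfl fun x _ => ?_
      have h2 := proj_pyth hr.2.1 hr.2.2 x (q x)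
      have h3 : r (q x) = r x := congrArg (fun T : H →L[ℂ] H => T x) hrq'
      rw [h3] at h2
      simpa using h2
    by_cases hc : ∑ x ∈ F, ‖r x‖ ^ 2 ≤ (∑ x ∈ F, ‖q x‖ ^ 2) / 2
    · refine ⟨r, hr, hr0, ?_, ?_⟩
      · rw [← hqr, ← mul_assoc, hpq]
      · rw [pow_succ, ← div_div]; linarith
    · refine ⟨q - r, ⟨sub_mem hq.1 hr.1, ?_, ?_⟩, ?_, ?_, ?_⟩
      · rw [star_sub, hq.2.1, hr.2.1]
      · rw [sub_mul, mul_sub, mul_sub, hq.2.2, hr.2.2, hqr, hrq']; abel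
      · exact sub_ne_zero.2 (Ne.symm hrq)
      · rw [mul_sub, hpq]; congr 1; rw [← hqr, ← mul_assoc, hpq]
      · rw [pow_succ, ← div_div]; linarith

lemma proj_small' (M : VonNeumannAlgebra H) (hM : M.Atomless) (F : Finset H)
    (p : H →L[ℂ] H) (hp : IsProjectionIn M p) (hp0 : p ≠ 0) (δ : ℝ) (hδ : 0 < δ) :
    ∃ q, IsProjectionIn M q ∧ q ≠ 0 ∧ p * q = q ∧ ∀ x ∈ F, ‖q x‖ ≤ δ := by
  have ht : Tendsto (fun n : ℕ => (∑ x ∈ F, ‖p x‖ ^ 2) / (2:ℝ) ^ n) atTop (𝓝 0) :=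
    tendsto_const_nhds.div_atTop (tendsto_pow_atTop_atTop_of_one_lt (by norm_num))
  obtain ⟨n, hn⟩ := (ht.eventually (gt_mem_nhds (show (0:ℝ) < δ ^ 2 by positivity))).exists
  obtain ⟨q, hq, hq0, hpq, hle⟩ := proj_small M hM F p hp hp0 n
  refine ⟨q, hq, hq0, hpq, fun x hx => ?_⟩
  have h1 : ‖q x‖ ^ 2 ≤ ∑ x ∈ F, ‖q x‖ ^ 2 :=
    Finset.single_le_sum (f := fun x => ‖q x‖ ^ 2) (fun i _ => by positivity) hx
  exact (abs_le_of_sq_le_sq' (by linarith) hδ.le).2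

lemma exists_limit (M : VonNeumannAlgebra H) (G : ℕ → (H →L[ℂ] H)) (hG : ∀ n, G n ∈ M)
    (hG1 : ∀ n, ‖G n‖ ≤ 1) :
    ∃ g ∈ M, ∀ (x a : H) (R : ℝ) (m : ℕ), (∀ k ≥ m, ‖G k x - a‖ ≤ R) → ‖g x - a‖ ≤ R := by
  have hb : ∀ ξ η : H, ∀ n, ‖inner ℂ (G n ξ) η‖ ≤ ‖ξ‖ * ‖η‖ := fun ξ η n => by
    refine (norm_inner_le_norm _ _).trans ?_
    gcongr
    simpa using (G n).le_of_opNorm_le (hG1 n) ξ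
  have hex : ∀ ξ η : H, ∃ c : ℂ,
      Tendsto (fun n => inner ℂ (G n ξ) η) (hyperfilter ℕ : Filter ℕ) (𝓝 c) := fun ξ η => by
    have hc := isCompact_closedBall (0 : ℂ) (‖ξ‖ * ‖η‖)
    obtain ⟨c, -, hc⟩ := hc.ultrafilter_le_nhds ((hyperfilter ℕ).map (fun n => inner ℂ (G n ξ) η))
      (by
        rw [le_principal_iff]
        refine Filter.mem_map.2 (Filter.mem_of_superset Filter.univ_mem fun n _ => ?_)
        simpa using hb ξ η n)
    exact ⟨c, hc⟩
  choose B hB using hex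
  let L : H →ₗ⋆[ℂ] H →ₗ[ℂ] ℂ := LinearMap.mk₂'ₛₗ (starRingEnd ℂ) (RingHom.id ℂ) B
    (fun a b c => tendsto_nhds_unique (hB (a + b) c)
      (((hB a c).add (hB b c)).congr fun n => by simp))
    (fun r a c => tendsto_nhds_unique (hB (r • a) c)
      (((hB a c).const_mul (starRingEnd ℂ r)).congr fun n => by simp [mul_comm]))
    (fun a b c => tendsto_nhds_unique (hB a (b + c))
      (((hB a b).add (hB a c)).congr fun n => by simp))
    (fun r a c => tendsto_nhds_unique (hB a (r • c))
      (((hB a c).const_mul r).congr fun n => by simp))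
  let L' : H →L⋆[ℂ] H →L[ℂ] ℂ := L.mkContinuous₂ 1 (fun ξ η => by
    have := le_of_tendsto (hB ξ η).norm (Eventually.of_forall (hb ξ η))
    simpa [L] using this)
  let g := InnerProductSpace.continuousLinearMapOfBilin L'
  have hg : ∀ ξ η, inner ℂ (g ξ) η = B ξ η := fun ξ η => by
    rw [InnerProductSpace.continuousLinearMapOfBilin_apply]; rfl
  refine ⟨g, ?_, ?_⟩
  · rw [← M.commutant_commutant, VonNeumannAlgebra.mem_commutant_iff]
    intro c hc
    rw [VonNeumannAlgebra.mem_commutant_iff] at hc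
    ext ξ
    refine ext_inner_right ℂ fun η => ?_
    have h1 : inner ℂ ((c * g) ξ) η = B ξ (star c η) := by
      rw [← hg, ContinuousLinearMap.star_eq_adjoint, ContinuousLinearMap.adjoint_inner_right]; rfl
    have h2 : inner ℂ ((g * c) ξ) η = B (c ξ) η := by rw [← hg]; rfl
    rw [h1, h2]
    refine tendsto_nhds_unique (hB ξ (star c η)) ((hB (c ξ) η).congr fun n => ?_)
    rw [ContinuousLinearMap.star_eq_adjoint, ContinuousLinearMap.adjoint_inner_right]
    congr 1
    exact congrArg (fun T : H →L[ℂ] H => T ξ) (hc _ (hG n))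
  · intro x a R m h
    have h3 : ∀ η, ‖inner ℂ (g x - a) η‖ ≤ R * ‖η‖ := fun η => by
      have ht : Tendsto (fun n => ‖inner ℂ (G n x - a) η‖) (hyperfilter ℕ : Filter ℕ)
          (𝓝 ‖inner ℂ (g x - a) η‖) := by
        simp_rw [inner_sub_left, hg]
        exact ((hB x η).sub_const _).norm
      refine le_of_tendsto ht ?_
      have : ∀ᶠ k in (hyperfilter ℕ : Filter ℕ), k ≥ m :=
        Filter.Eventually.filter_mono Nat.hyperfilter_le_atTop (eventually_ge_atTop m)
      filter_upwards [this] with k hk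
      refine (norm_inner_le_norm _ _).trans ?_
      gcongr
      exact h k hk
    have h4 := h3 (g x - a)
    rw [inner_self_eq_norm_sq_to_K] at h4
    have h5 : ‖g x - a‖ * ‖g x - a‖ ≤ R * ‖g x - a‖ := by
      simpa [sq] using h4
    by_contra! hlt
    have hR : 0 ≤ R := (norm_nonneg _).trans (h m le_rfl)
    nlinarith

lemma star_mul_cfc (y : H →L[ℂ] H) (h : ℝ → ℝ) (hh : Continuous h) :
    star (y * cfc h (star y * y)) * (y * cfc h (star y * y))
      = cfc (fun t => h t * t * h t) (star y * y) := by
  have ha : IsSelfAdjoint (star y * y) := IsSelfAdjoint.star_mul_self y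
  have hs : star (cfc h (star y * y)) = cfc h (star y * y) := cfc_predicate h (star y * y)
  rw [cfc_mul (fun t => h t * t) h (star y * y) (by fun_prop) (by fun_prop),
    cfc_mul h (fun t => t) (star y * y) (by fun_prop) (by fun_prop), cfc_id' ℝ (star y * y), star_mul, hs]
  simp only [mul_assoc]

lemma norm_le_of_star_mul_le (S T : H →L[ℂ] H) (h : star S * S ≤ star T * T) (z : H) :
    ‖S z‖ ≤ ‖T z‖ := by
  rw [ContinuousLinearMap.le_def] at h
  have h1 := h.re_inner_nonneg_left z
  have key : ∀ S : H →L[ℂ] H, RCLike.re (inner ℂ ((star S * S) z) z) = ‖S z‖ ^ 2 := fun S => by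
    have : inner ℂ ((star S * S) z) z = inner ℂ (S z) (S z) := by
      rw [← ContinuousLinearMap.adjoint_inner_left S]; rfl
    rw [this, inner_self_eq_norm_sq]
  rw [ContinuousLinearMap.sub_apply, inner_sub_left, map_sub, key, key] at h1
  exact (abs_le_of_sq_le_sq' (by linarith) (norm_nonneg _)).2

lemma cfc_mem_vN (M : VonNeumannAlgebra H) (a : H →L[ℂ] H) (ha : a ∈ M) (f : ℝ → ℝ) :
    cfc f a ∈ M := by
  rw [← M.commutant_commutant, VonNeumannAlgebra.mem_commutant_iff]
  intro c hc
  rw [VonNeumannAlgebra.mem_commutant_iff] at hc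
  have : Commute a c := hc a ha
  exact (this.cfc_real f).symm

lemma exists_top_proj [Nontrivial H] (M : VonNeumannAlgebra H) (y : H →L[ℂ] H) (hy : y ∈ M)
    (δ : ℝ) (hδ : 0 < δ) :
    ∃ v ∈ M, ∃ p, IsProjectionIn M p ∧ p ≠ 0 ∧
      ∀ x, p x = x → star v (v x) = x ∧ (‖y‖ + 1 - δ) * ‖x‖ ≤ ‖y x + v x‖ := by
  by_cases hy0 : y = 0
  · subst hy0
    refine ⟨1, one_mem _, 1, ⟨one_mem _, by simp, by simp⟩, one_ne_zero, fun x _ => ⟨by simp, ?_⟩⟩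
    simp only [norm_zero, ContinuousLinearMap.zero_apply, ContinuousLinearMap.one_apply, zero_add]
    nlinarith [norm_nonneg x]
  have hny : 0 < ‖y‖ := norm_pos_iff.2 hy0
  obtain ⟨c, hc0, hcy, hcδ⟩ : ∃ c : ℝ, 0 < c ∧ c < ‖y‖ ∧ ‖y‖ - δ ≤ c :=
    ⟨max (‖y‖ / 2) (‖y‖ - δ), by positivity, max_lt (by linarith) (by linarith), le_max_right _ _⟩
  set a := star y * y with hadef
  have haM : a ∈ M := mul_mem (star_mem hy) hy
  have ha : IsSelfAdjoint a := IsSelfAdjoint.star_mul_self y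
  have ha0 : 0 ≤ a := star_mul_self_nonneg y
  have hspec : ∀ t ∈ spectrum ℝ a, 0 ≤ t := fun t ht => spectrum_nonneg_of_nonneg ha0 ht
  let k : ℝ → ℝ := fun t => (√(max t (c ^ 2)))⁻¹
  have hkpos : ∀ t, 0 < √(max t (c ^ 2)) := fun t => Real.sqrt_pos.2 (by positivity)
  have hk : Continuous k := by
    refine Continuous.inv₀ (by fun_prop) fun t => (hkpos t).ne'
  let f : ℝ → ℝ := fun t => max 0 (t - c ^ 2)
  have hf : Continuous f := by fun_prop
  let b := cfc f a
  let v := y * cfc k a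
  have hbM : b ∈ M := cfc_mem_vN M a haM f
  have hvM : v ∈ M := mul_mem hy (cfc_mem_vN M a haM k)
  have hb0 : b ≠ 0 := by
    intro hb
    have h1 : ‖a‖ ∈ spectrum ℝ a := CStarAlgebra.norm_mem_spectrum_of_nonneg ha0
    have h2 : f ‖a‖ ∈ spectrum ℝ b := by
      rw [cfc_map_spectrum f a]
      exact ⟨_, h1, rfl⟩
    rw [hb, spectrum.zero_eq] at h2
    have h3 : ‖a‖ = ‖y‖ * ‖y‖ := CStarRing.norm_star_mul_self
    have h4 : f ‖a‖ = 0 := h2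
    have h5 : ‖a‖ - c ^ 2 ≤ f ‖a‖ := le_max_right _ _
    nlinarith
  have hvb : star v * v * b = b := by
    have h1 : star v * v = cfc (fun t => k t * t * k t) a := star_mul_cfc y k hk
    rw [h1, ← cfc_mul _ f a (by fun_prop) (by fun_prop)]
    refine cfc_congr fun t ht => ?_
    rcases le_or_gt t (c ^ 2) with h | h
    · have : f t = 0 := max_eq_left (by linarith)
      simp [this]
    · have ht0 : 0 < t := lt_trans (by positivity) h
      have : k t = (√t)⁻¹ := by simp only [k]; rw [max_eq_left h.le]
      have h2 : (√t)⁻¹ * t * (√t)⁻¹ = 1 := by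
        have := Real.sq_sqrt ht0.le
        have h3 : √t ≠ 0 := (Real.sqrt_pos.2 ht0).ne'
        field_simp
        exact this.symm
      simp only [this, h2, one_mul]
  have hyvb : ∀ z, (c + 1) * ‖b z‖ ≤ ‖y (b z) + v (b z)‖ := fun z => by
    let h : ℝ → ℝ := fun t => (1 + k t) * f t
    have hh : Continuous h := by fun_prop
    have h1 : y * b + v * b = y * cfc h a := by
      have : cfc h a = (1 + cfc k a) * b := by
        rw [show h = fun t => (fun s => 1 + k s) t * f t from rfl,
          cfc_mul (fun s => 1 + k s) f a (by fun_prop) (by fun_prop),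
          cfc_const_add (1:ℝ) k a (by fun_prop)]
        simp [b]
      rw [this, add_mul, one_mul, mul_add]
      simp only [v, mul_assoc]
    let S := cfc (fun t => (c + 1) * f t) a
    have hS : S = (c + 1) • b := cfc_const_mul (c + 1) f a (by fun_prop)
    have hSs : star S = S := cfc_predicate (fun t => (c + 1) * f t) a
    have hle : star S * S ≤ star (y * cfc h a) * (y * cfc h a) := by
      rw [star_mul_cfc y h hh, hSs, ← cfc_mul _ _ a (by fun_prop) (by fun_prop)]
      refine cfc_mono (fun t ht => ?_) (by fun_prop) (by fun_prop)
      rcases le_or_gt t (c ^ 2) with h' | h'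
      · have : f t = 0 := max_eq_left (by linarith)
        simp [this, h]
      · have ht0 : 0 < t := lt_trans (by positivity) h'
        have hkt : k t = (√t)⁻¹ := by simp only [k]; rw [max_eq_left h'.le]
        have hsq := Real.sq_sqrt ht0.le
        have hs0 : 0 < √t := Real.sqrt_pos.2 ht0
        have h2 : (1 + (√t)⁻¹) * (1 + (√t)⁻¹) * t = (√t + 1) ^ 2 := by
          field_simp
          rw [hsq]
        have hcs : c ≤ √t := Real.le_sqrt_of_sq_le h'.le
        have h3 : (c + 1) ^ 2 ≤ (√t + 1) ^ 2 := by gcongr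
        simp only [h, hkt]
        calc (c + 1) * f t * ((c + 1) * f t) = (c + 1) ^ 2 * (f t) ^ 2 := by ring
          _ ≤ (√t + 1) ^ 2 * (f t) ^ 2 := by gcongr
          _ = _ := by rw [← h2]; ring
    have h4 := norm_le_of_star_mul_le _ _ hle z
    rw [← h1, hS] at h4
    have h5 : ‖((c + 1) • b) z‖ = (c + 1) * ‖b z‖ := by
      rw [ContinuousLinearMap.smul_apply, norm_smul, Real.norm_of_nonneg (by positivity)]
    rw [h5] at h4
    exact h4
  let K := b.range.topologicalClosure
  have : CompleteSpace K := (Submodule.isClosed_topologicalClosure _).completeSpace_coe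
  have hKb : ∀ x ∈ K, x ∈ closure (Set.range b) := fun x hx => by
    have : x ∈ closure (b.range : Set H) := hx
    exact this
  have hpstar : IsStarProjection K.starProjection := isStarProjection_starProjection
  refine ⟨v, hvM, K.starProjection, ⟨?_, hpstar.isSelfAdjoint, hpstar.isIdempotentElem⟩, ?_, ?_⟩
  · rw [VonNeumannAlgebra.IsStarProjection.mem_iff hpstar]
    intro c hc
    rw [VonNeumannAlgebra.mem_commutant_iff] at hc
    rw [Submodule.range_starProjection, Module.End.mem_invtSubmodule]
    intro x hx
    have hx' := hKb x hx
    have hm : Set.MapsTo c (Set.range b) (Set.range b) := by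
      rintro _ ⟨z, rfl⟩
      exact ⟨c z, congrArg (fun T : H →L[ℂ] H => T z) (hc b hbM)⟩
    have := hm.closure c.continuous hx'
    exact this
  · intro h0
    apply hb0
    ext z
    have hz : b z ∈ K := Submodule.le_topologicalClosure _ ⟨z, rfl⟩
    have := Submodule.starProjection_eq_self_iff.2 hz
    rw [h0] at this
    simpa using this.symm
  · intro x hx
    have hx' := hKb x (Submodule.starProjection_eq_self_iff.1 hx)
    have hcl : IsClosed {x : H | star v (v x) = x ∧ (c + 1) * ‖x‖ ≤ ‖y x + v x‖} :=
      by
      refine IsClosed.and ?_ ?_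
      · exact isClosed_eq (by fun_prop) (by fun_prop)
      · exact isClosed_le (by fun_prop) (by fun_prop)
    have hsub : Set.range b ⊆ {x : H | star v (v x) = x ∧ (c + 1) * ‖x‖ ≤ ‖y x + v x‖} := by
      rintro _ ⟨z, rfl⟩
      exact ⟨congrArg (fun T : H →L[ℂ] H => T z) hvb, hyvb z⟩
    obtain ⟨h1, h2⟩ := closure_minimal hsub hcl hx'
    refine ⟨h1, le_trans ?_ h2⟩
    gcongr
    linarith

lemma step_lemma [Nontrivial H] (M : VonNeumannAlgebra H) (hM : M.Atomless)
    (f : H →L[ℂ] H) (hf : f ∈ M) (hf1 : ‖f‖ ≤ 1) (y : H →L[ℂ] H) (hy : y ∈ M)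
    (F : Finset H) (δ : ℝ) (hδ : 0 < δ) :
    ∃ g ∈ M, ‖g‖ ≤ 1 ∧ (∀ x ∈ F, ‖g x - f x‖ ≤ δ) ∧
      ∃ x, ‖x‖ = 1 ∧ ‖y‖ + 1 - δ ≤ ‖g x - y x‖ := by
  classical
  obtain ⟨v, hv, p, hp, hp0, hpx⟩ := exists_top_proj M y hy δ hδ
  obtain ⟨q, hq, hq0, hpq, hqF⟩ := proj_small' M hM (F ∪ F.image fun x => star v (f x)) p hp hp0
    (δ / 4) (by positivity)
  have hqq : ∀ z, q (q z) = q z := fun z => congrArg (fun T : H →L[ℂ] H => T z) hq.2.2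
  have hqx : ∀ z, star v (v (q z)) = q z ∧ (‖y‖ + 1 - δ) * ‖q z‖ ≤ ‖y (q z) + v (q z)‖ :=
    fun z => hpx (q z) (congrArg (fun T : H →L[ℂ] H => T z) hpq)
  have hvn : ∀ z, ‖v (q z)‖ = ‖q z‖ := fun z => by
    have h : inner ℂ (v (q z)) (v (q z)) = inner ℂ (q z) (q z) := by
      rw [← ContinuousLinearMap.adjoint_inner_left v, ← ContinuousLinearMap.star_eq_adjoint, (hqx z).1]
    have h2 := congrArg RCLike.re h
    rw [inner_self_eq_norm_sq, inner_self_eq_norm_sq] at h2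
    exact (sq_eq_sq₀ (norm_nonneg _) (norm_nonneg _)).1 h2
  let r := v * q * star v
  have hrM : r ∈ M := mul_mem (mul_mem hv hq.1) (star_mem hv)
  have hrs : star r = r := by simp [r, hq.2.1, mul_assoc]
  have hr : ∀ z, r z = v (q (star v z)) := fun z => rfl
  have hrv : ∀ z, r (v (q z)) = v (q z) := fun z => by rw [hr, (hqx z).1, hqq]
  have hrr : r * r = r := by
    ext z
    change r (r z) = r z
    rw [hr z, hrv]
  have hfn : ∀ z, ‖f z‖ ≤ ‖z‖ := fun z => by simpa using f.le_of_opNorm_le hf1 z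
  have hqn : ∀ z, ‖q z‖ ^ 2 + ‖z - q z‖ ^ 2 = ‖z‖ ^ 2 := fun z => by
    rw [← proj_pyth hq.2.1 hq.2.2]; simp
  have hrn : ∀ z, ‖r z‖ ^ 2 + ‖z - r z‖ ^ 2 = ‖z‖ ^ 2 := fun z => by
    rw [← proj_pyth hrs hrr]; simp
  let g := (1 - r) * f * (1 - q) - v * q
  have hg : ∀ z, g z = f (z - q z) - r (f (z - q z)) - v (q z) := fun z => rfl
  refine ⟨g, ?_, ?_, ?_, ?_⟩
  · exact sub_mem (mul_mem (mul_mem (sub_mem (one_mem _) hrM) hf) (sub_mem (one_mem _) hq.1))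
      (mul_mem hv hq.1)
  · refine ContinuousLinearMap.opNorm_le_bound _ zero_le_one fun z => ?_
    rw [one_mul]
    have h1 := proj_pyth hrs hrr (-(v (q z))) (f (z - q z))
    have h2 : r (-(v (q z))) + (f (z - q z) - r (f (z - q z))) = g z := by
      rw [hg, map_neg, hrv]; abel
    rw [h2, map_neg, hrv, norm_neg, hvn] at h1
    have h3 := hrn (f (z - q z))
    have h4 := hfn (z - q z)
    have h5 := hqn z
    have h6 : ‖f (z - q z)‖ ^ 2 ≤ ‖z - q z‖ ^ 2 := by gcongr
    exact (abs_le_of_sq_le_sq' (by nlinarith [sq_nonneg ‖r (f (z - q z))‖]) (norm_nonneg _)).2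
  · intro x hx
    have h1 : ‖q x‖ ≤ δ / 4 := hqF x (Finset.mem_union_left _ hx)
    have h2 : ‖q (star v (f x))‖ ≤ δ / 4 :=
      hqF _ (Finset.mem_union_right _ (Finset.mem_image_of_mem _ hx))
    rw [← hvn, ← hr] at h2
    have h3 : g x - f x = -r (f x) - (f (q x) - r (f (q x))) - v (q x) := by
      rw [hg]; simp only [map_sub]; abel
    have h4 : ‖f (q x) - r (f (q x))‖ ≤ ‖q x‖ := by
      have h5 := hrn (f (q x))
      refine le_trans ?_ (hfn (q x))
      exact (abs_le_of_sq_le_sq' (by nlinarith [sq_nonneg ‖r (f (q x))‖]) (norm_nonneg _)).2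
    rw [h3]
    have h6 := norm_sub_le (-r (f x) - (f (q x) - r (f (q x)))) (v (q x))
    have h7 := norm_sub_le (-r (f x)) (f (q x) - r (f (q x)))
    rw [norm_neg] at h7
    rw [hvn] at h6
    linarith
  · obtain ⟨z, hz⟩ : ∃ z, q z ≠ 0 := by
      by_contra! h
      exact hq0 (by ext z; simpa using h z)
    let w := ((‖q z‖ : ℂ)⁻¹) • z
    have hqw : ‖q w‖ = 1 := by
      simp only [w, map_smul, norm_smul, norm_inv, Complex.norm_real, norm_norm]
      exact inv_mul_cancel₀ (norm_ne_zero_iff.2 hz)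
    refine ⟨q w, hqw, ?_⟩
    have h1 := (hqx w).2
    rw [hqw, mul_one] at h1
    have h2 : g (q w) - y (q w) = -(y (q w) + v (q w)) := by
      rw [hg, hqq, sub_self, map_zero, map_zero]; abel
    rw [h2, norm_neg]
    exact h1

lemma exists_seq [Nontrivial H] (M : VonNeumannAlgebra H) (hM : M.Atomless)
    (y : ℕ → (H →L[ℂ] H)) (hy : ∀ n, y n ∈ M) (d : ℕ → ℝ) (hd : ∀ n, 0 < d n) :
    ∃ (G : ℕ → (H →L[ℂ] H)) (x : ℕ → H), (∀ n, G n ∈ M) ∧ (∀ n, ‖G n‖ ≤ 1) ∧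
      (∀ n, ‖x n‖ = 1) ∧ (∀ n, ‖y n‖ + 1 - d n ≤ ‖G (n + 1) (x n) - y n (x n)‖) ∧
      ∀ m n, m < n → ‖G (n + 1) (x m) - G n (x m)‖ ≤ d n := by
  classical
  let St := {s : (H →L[ℂ] H) × Finset H // s.1 ∈ M ∧ ‖s.1‖ ≤ 1}
  have hstep : ∀ (n : ℕ) (s : St), ∃ t : St × H,
      (∀ x ∈ s.1.2, ‖t.1.1.1 x - s.1.1 x‖ ≤ d n) ∧ ‖t.2‖ = 1 ∧
      ‖y n‖ + 1 - d n ≤ ‖t.1.1.1 t.2 - y n t.2‖ ∧ t.1.1.2 = insert t.2 s.1.2 := fun n s => by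
    obtain ⟨g, hgM, hg1, hgF, x, hx, hxy⟩ :=
      step_lemma M hM s.1.1 s.2.1 s.2.2 (y n) (hy n) s.1.2 (d n) (hd n)
    exact ⟨(⟨(g, insert x s.1.2), hgM, hg1⟩, x), hgF, hx, hxy, rfl⟩
  choose T hT1 hT2 hT3 hT4 using hstep
  let S : ℕ → St := fun n => Nat.rec ⟨(0, ∅), zero_mem M, by simp⟩ (fun n s => (T n s).1) n
  have hS : ∀ n, S (n + 1) = (T n (S n)).1 := fun n => rfl
  have hmem : ∀ m n, m < n → (T m (S m)).2 ∈ (S n).1.2 := by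
    intro m n hmn
    induction n with
    | zero => omega
    | succ n ih =>
      rw [hS, hT4]
      rcases Nat.lt_succ_iff_lt_or_eq.1 hmn with h | h
      · exact Finset.mem_insert_of_mem (ih h)
      · subst h; exact Finset.mem_insert_self _ _
  refine ⟨fun n => (S n).1.1, fun n => (T n (S n)).2, fun n => (S n).2.1, fun n => (S n).2.2,
    fun n => hT2 n (S n), fun n => hT3 n (S n), fun m n hmn => hT1 n (S n) _ (hmem m n hmn)⟩
/-- **Theorem 3.5, first part.** Let `M` be an atomless von Neumann
algebra on a nontrivial Hilbert space `H`.  Then for every sequence `(y_n)` in `M`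
and every `ε > 0` there exists `g ∈ M` with `‖g - y_n‖ > ‖y_n‖ + 1 - ε` for all `n`. -/
theorem exists_far_elt_of_atomless [Nontrivial H]
    (M : VonNeumannAlgebra H) (hM : M.Atomless)
    (y : ℕ → (H →L[ℂ] H)) (hy : ∀ n, y n ∈ M) (ε : ℝ) (hε : 0 < ε) :
    ∃ g ∈ M, ∀ n, ‖g - y n‖ > ‖y n‖ + 1 - ε := by
  have hd : ∀ n : ℕ, 0 < ε / 4 * (1 / 2) ^ (n + 1) := fun n => by positivity
  obtain ⟨G, x, hGM, hG1, hx, hxy, hGx⟩ := exists_seq M hM y hy _ hd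
  obtain ⟨g, hgM, hg⟩ := exists_limit M G hGM hG1
  refine ⟨g, hgM, fun n => ?_⟩
  have h1 : ∀ k ≥ n + 1, ‖G k (x n) - G (n + 1) (x n)‖ ≤ ε / 4 * (1 - (1 / 2) ^ k) := by
    intro k hk
    induction k, hk using Nat.le_induction with
    | base =>
      rw [sub_self, norm_zero]
      have : ((1:ℝ) / 2) ^ (n + 1) ≤ 1 := pow_le_one₀ (by norm_num) (by norm_num)
      have h0 : 0 ≤ 1 - ((1:ℝ) / 2) ^ (n + 1) := by linarith
      positivity
    | succ k hk ih =>
      have h2 := hGx n k (by omega)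
      have h3 := norm_add_le (G (k + 1) (x n) - G k (x n)) (G k (x n) - G (n + 1) (x n))
      rw [sub_add_sub_cancel] at h3
      have h4 : ((1:ℝ) / 2) ^ (k + 1) = (1 / 2) ^ k / 2 := by rw [pow_succ]; ring
      rw [h4] at h2 ⊢
      linarith
  have h2 : ‖g (x n) - G (n + 1) (x n)‖ ≤ ε / 4 := hg _ _ _ (n + 1) fun k hk => by
    refine (h1 k hk).trans ?_
    have : 0 < ((1:ℝ) / 2) ^ k := by positivity
    nlinarith
  have h3 := hxy n
  have h4 : ε / 4 * (1 / 2) ^ (n + 1) ≤ ε / 4 := by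
    have : ((1:ℝ) / 2) ^ (n + 1) ≤ 1 := pow_le_one₀ (by norm_num) (by norm_num)
    nlinarith
  have h5 : ‖(g - y n) (x n)‖ ≤ ‖g - y n‖ := by
    simpa [hx n] using (g - y n).le_opNorm (x n)
  have h6 := norm_sub_le (g (x n) - y n (x n)) (g (x n) - G (n + 1) (x n))
  rw [sub_sub_sub_cancel_left] at h6
  rw [ContinuousLinearMap.sub_apply] at h5
  have h7 : ‖G (n + 1) (x n) - y n (x n)‖ ≤ ‖g (x n) - y n (x n)‖ + ‖g (x n) - G (n + 1) (x n)‖ := h6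
  linarith
end
end

section
/- Let H be a nontrivial complex Hilbert space and let M be an atomless von Neumann algebra on H. Then M, regarded as a normed space with the operator norm, does not have the ball-covering property. -/
noncomputable section

variable {H : Type*} [NormedAddCommGroup H] [InnerProductSpace ℂ H] [CompleteSpace H]

/-- A subset `S` of a normed space has the ball-covering property if there is a countable
family of open balls with centers in `S`, none of which contains the origin, whose union
covers `{x ∈ S : ‖x‖ = 1}`.  (Radii `r n ≤ 0` give empty balls, so this also allows
finite or empty families.) -/
def HasBCPOn {E : Type*} [NormedAddCommGroup E] (S : Set E) : Prop :=
  ∃ (c : ℕ → E) (r : ℕ → ℝ), (∀ n, c n ∈ S) ∧ (∀ n, r n ≤ ‖c n‖) ∧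
    ∀ x ∈ S, ‖x‖ = 1 → ∃ n, ‖x - c n‖ < r n


open scoped InnerProductSpace
open ContinuousLinearMap

theorem proj_of_invariant (M : VonNeumannAlgebra H) (K : Submodule ℂ H) [K.HasOrthogonalProjection]
    (hK : ∀ y ∈ M.commutant, ∀ v ∈ K, y v ∈ K) : IsProjectionIn M K.starProjection := by
  have hs : IsStarProjection K.starProjection := isStarProjection_starProjection
  refine ⟨?_, hs.isSelfAdjoint, hs.isIdempotentElem⟩
  rw [VonNeumannAlgebra.IsStarProjection.mem_iff hs]
  intro y hy
  rw [Module.End.mem_invtSubmodule]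
  intro v hv
  have hv' : v ∈ K := by
    obtain ⟨u, rfl⟩ := hv
    exact K.starProjection_apply_mem u
  have := hK y hy v hv'
  exact ⟨y v, Submodule.starProjection_eq_self_iff.2 this⟩

theorem mem_of_commute (M : VonNeumannAlgebra H) (x : H →L[ℂ] H)
    (h : ∀ y ∈ M.commutant, Commute x y) : x ∈ M := by
  rw [← M.commutant_commutant, VonNeumannAlgebra.mem_commutant_iff]
  intro g hg
  exact (h g hg).symm.eq

theorem commute_commutant (M : VonNeumannAlgebra H) {x y : H →L[ℂ] H} (hx : x ∈ M)
    (hy : y ∈ M.commutant) : Commute x y :=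
  VonNeumannAlgebra.mem_commutant_iff.1 hy x hx

/-- `g` is the range projection of `T`. -/
def IsRangeProj (T g : H →L[ℂ] H) : Prop :=
  g * T = T ∧ ∀ S : H →L[ℂ] H, S * T = 0 → S * g = 0

theorem exists_rangeProj (M : VonNeumannAlgebra H) (T : H →L[ℂ] H) (hT : T ∈ M) :
    ∃ g, IsProjectionIn M g ∧ IsRangeProj T g := by
  let K : Submodule ℂ H := T.range.topologicalClosure
  have : CompleteSpace K := T.range.isClosed_topologicalClosure.completeSpace_coe
  refine ⟨K.starProjection, proj_of_invariant M K ?_, ?_, ?_⟩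
  · intro y hy v hv
    refine map_mem_closure (s := (T.range : Set H)) (t := (T.range : Set H)) y.continuous hv ?_
    rintro _ ⟨u, rfl⟩
    refine ⟨y u, ?_⟩
    exact congr($((commute_commutant M hT hy).eq) u)
  · ext v
    exact Submodule.starProjection_eq_self_iff.2 (T.range.le_topologicalClosure ⟨v, rfl⟩)
  · intro S hS
    ext v
    have h1 : K ≤ S.ker := by
      apply Submodule.topologicalClosure_minimal
      · rintro _ ⟨u, rfl⟩
        exact congr($hS u)
      · exact S.isClosed_ker
    exact h1 (K.starProjection_apply_mem v)

theorem IsRangeProj.commute {M : VonNeumannAlgebra H} {T g b : H →L[ℂ] H} (h : IsRangeProj T g)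
    (hg : IsProjectionIn M g) (hb : star b = b) (hTb : Commute T b) : Commute g b := by
  have h1 : (1 - g) * b * T = 0 := by
    rw [mul_assoc, ← hTb.eq, ← mul_assoc, sub_mul, h.1, one_mul, sub_self, zero_mul]
  have h2 := h.2 _ h1
  have h3 : b * g = g * b * g := by
    rw [sub_mul, sub_mul, one_mul, sub_eq_zero] at h2
    exact h2
  have h4 := congr(star $h3)
  simp only [star_mul, hg.2.1, hb, ← mul_assoc] at h4
  exact h4.trans h3.symm

theorem posPart_commute {x y : H →L[ℂ] H} (h : Commute x y) : Commute x⁺ y := by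
  rw [CFC.posPart_def]; exact h.cfcₙ_real _

theorem negPart_commute {x y : H →L[ℂ] H} (h : Commute x y) : Commute x⁻ y := by
  rw [CFC.negPart_def]; exact h.cfcₙ_real _

theorem posPart_mem {M : VonNeumannAlgebra H} {x : H →L[ℂ] H} (h : x ∈ M) : x⁺ ∈ M :=
  mem_of_commute M _ fun _ hy => posPart_commute (commute_commutant M h hy)

theorem posPart_ne_zero {x : H →L[ℂ] H} (hx : IsSelfAdjoint x) {w : H}
    (hw : 0 < (⟪x w, w⟫_ℂ).re) : x⁺ ≠ 0 := by
  intro h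
  have h1 := (CFC.posPart_eq_zero_iff x hx).1 h
  have h2 := ((nonneg_iff_isPositive _).1 (neg_nonneg.2 h1)).re_inner_nonneg_left w
  simp at h2
  linarith

theorem negPart_ne_zero {x : H →L[ℂ] H} (hx : IsSelfAdjoint x) {w : H}
    (hw : (⟪x w, w⟫_ℂ).re < 0) : x⁻ ≠ 0 := by
  intro h
  have h1 := (CFC.negPart_eq_zero_iff x hx).1 h
  have h2 := ((nonneg_iff_isPositive _).1 h1).re_inner_nonneg_left w
  simp at h2
  linarith

theorem one_proj (M : VonNeumannAlgebra H) : IsProjectionIn M 1 :=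
  ⟨one_mem M, by simp, by simp⟩

theorem exists_spectral_s5 [Nontrivial H] (M : VonNeumannAlgebra H) (c : H →L[ℂ] H) (hc : c ∈ M)
    (ε : ℝ) (hε : 0 < ε) :
    ∃ e, IsProjectionIn M e ∧ e ≠ 0 ∧ ∀ v, e v = v → (‖c‖ - ε) * ‖v‖ ≤ ‖c v‖ := by
  rcases le_or_gt (‖c‖ - ε) 0 with h0 | h0
  · refine ⟨1, one_proj M, one_ne_zero, fun v _ => ?_⟩
    exact (mul_nonpos_of_nonpos_of_nonneg h0 (norm_nonneg _)).trans (norm_nonneg _)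
  set t : ℝ := ‖c‖ - ε with ht
  let x : H →L[ℂ] H := star c * c - ((t ^ 2 : ℝ) : ℂ) • 1
  have hx : IsSelfAdjoint x := by
    simp [x, IsSelfAdjoint]
  have hxM : x ∈ M := by
    refine sub_mem (mul_mem (star_mem hc) hc) ?_
    exact M.toStarSubalgebra.smul_mem (one_mem M) _
  have hq : ∀ v, (⟪x v, v⟫_ℂ).re = ‖c v‖ ^ 2 - t ^ 2 * ‖v‖ ^ 2 := by
    intro v
    have h1 : ∀ u : H, (⟪u, u⟫_ℂ).re = ‖u‖ ^ 2 := fun u => inner_self_eq_norm_sq (𝕜 := ℂ) u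
    have h2 : x v = adjoint c (c v) - ((t ^ 2 : ℝ) : ℂ) • v := rfl
    rw [h2, inner_sub_left, inner_smul_left, adjoint_inner_left, Complex.sub_re,
      Complex.conj_ofReal, Complex.re_ofReal_mul, h1, h1]
  obtain ⟨e, he, he1, he2⟩ := exists_rangeProj M x⁺ (posPart_mem hxM)
  refine ⟨e, he, ?_, ?_⟩
  · rintro rfl
    have hx0 : x⁺ = 0 := by rw [← he1, zero_mul]
    have : ‖c‖ ≤ t := by
      refine c.opNorm_le_bound h0.le fun v => ?_
      by_contra! hv
      refine posPart_ne_zero hx (w := v) ?_ hx0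
      rw [hq, ← mul_pow, sub_pos]
      exact pow_lt_pow_left₀ hv (by positivity) two_ne_zero
    linarith
  · intro v hv
    have h1 : x⁻ * e = 0 := he2 _ (CFC.negPart_mul_posPart x)
    have h2 : x v = x⁺ v := by
      have h3 : x⁻ v = 0 := by
        have := congr($h1 v)
        simpa [hv] using this
      conv_lhs => rw [← CFC.posPart_sub_negPart x hx]
      simp [h3]
    have h3 := ((nonneg_iff_isPositive _).1 (CFC.posPart_nonneg x)).re_inner_nonneg_left v
    rw [← h2] at h3
    have h4 := hq v
    simp at h3
    refine le_of_sq_le_sq ?_ (norm_nonneg _)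
    rw [mul_pow]; linarith

theorem exists_fixed {M : VonNeumannAlgebra H} {f : H →L[ℂ] H} (hf : IsProjectionIn M f)
    (h0 : f ≠ 0) : ∃ v, f v = v ∧ ‖v‖ = 1 := by
  obtain ⟨u, hu⟩ : ∃ u, f u ≠ 0 := by
    by_contra! h
    exact h0 (by ext u; simpa using h u)
  have hff : f (f u) = f u := congr($(hf.2.2) u)
  refine ⟨((‖f u‖⁻¹ : ℝ) : ℂ) • f u, by rw [map_smul, hff], ?_⟩
  rw [norm_smul, Complex.norm_real, norm_inv, norm_norm]
  exact inv_mul_cancel₀ (norm_ne_zero_iff.2 hu)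

/-- splitting through a self-adjoint element that is neither positive nor negative -/
theorem split_aux {M : VonNeumannAlgebra H} {f b x : H →L[ℂ] H}
    (hb : star b = b) (hx : IsSelfAdjoint x) (hxM : x ∈ M)
    (hfx : f * x = x) (hxf : x * f = x) (hxb : Commute x b)
    {v w : H} (hv : (⟪x v, v⟫_ℂ).re < 0) (hw : 0 < (⟪x w, w⟫_ℂ).re) :
    ∃ g, IsProjectionIn M g ∧ g ≠ 0 ∧ g ≠ f ∧ f * g = g ∧ Commute g b := by
  obtain ⟨g, hg, hr⟩ := exists_rangeProj M x⁺ (posPart_mem hxM)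
  have hcomm : Commute x f := hxf.trans hfx.symm
  have key : (f - 1) * x = 0 := by rw [sub_mul, hfx, one_mul, sub_self]
  have hpos : x⁺ ≠ 0 := posPart_ne_zero hx hw
  have hneg : x⁻ ≠ 0 := negPart_ne_zero hx hv
  have hdec := CFC.posPart_sub_negPart x hx
  -- `y * x = 0` kills both parts
  have hk : (f - 1) * x⁺ = 0 := by
    have h1 : ((f - 1) * x⁺) * star ((f - 1) * x⁺) = 0 := by
      have h2 : x * x⁺ = x⁺ * x⁺ := by
        have h7 : x * x⁺ = (x⁺ - x⁻) * x⁺ := by rw [hdec]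
        rw [h7, sub_mul, CFC.negPart_mul_posPart, sub_zero]
      have h3 : star x⁺ = x⁺ := (CFC.posPart_nonneg x).isSelfAdjoint
      rw [star_mul, h3, mul_assoc, ← mul_assoc x⁺, ← h2, mul_assoc, ← mul_assoc _ x, key, zero_mul]
    exact (CStarRing.mul_star_self_eq_zero_iff _).1 h1
  have hk2 : x⁻ * (f - 1) = 0 := by
    have h4 : x⁺ * (f - 1) = 0 := by
      have h5 : Commute x⁺ f := posPart_commute hcomm
      rw [(h5.sub_right (Commute.one_right _)).eq, hk]
    have h6 : x * (f - 1) = 0 := by rw [mul_sub, hxf, mul_one, sub_self]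
    rw [← hdec, sub_mul, h4, zero_sub, neg_eq_zero] at h6
    exact h6
  refine ⟨g, hg, ?_, ?_, ?_, hr.commute hg hb (posPart_commute hxb)⟩
  · rintro rfl
    exact hpos (by rw [← hr.1, zero_mul])
  · rintro rfl
    have h1 := hr.2 _ (CFC.negPart_mul_posPart x)
    rw [mul_sub, h1, mul_one, zero_sub, neg_eq_zero] at hk2
    exact hneg hk2
  · have := hr.2 _ hk
    rwa [sub_mul, one_mul, sub_eq_zero] at this

theorem split {M : VonNeumannAlgebra H} (hM : M.Atomless) {f b : H →L[ℂ] H}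
    (hf : IsProjectionIn M f) (hf0 : f ≠ 0) (hb : star b = b) (hbM : b ∈ M) (hfb : Commute f b) :
    ∃ g, IsProjectionIn M g ∧ g ≠ 0 ∧ g ≠ f ∧ f * g = g ∧ Commute g b := by
  obtain ⟨v, hfv, hv1⟩ := exists_fixed hf hf0
  obtain ⟨hfM, hfs, hff⟩ := hf
  have hsa : ∀ t : ℝ, IsSelfAdjoint (b * f - (t : ℂ) • f) := by
    intro t
    simp [IsSelfAdjoint, hfs, hb, hfb.eq]
  have hq : ∀ t : ℝ, ∀ u, (⟪(b * f - (t : ℂ) • f) u, u⟫_ℂ).re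
      = (⟪(b * f) u, u⟫_ℂ).re - t * ‖f u‖ ^ 2 := by
    intro t u
    have h1 : (⟪f u, f u⟫_ℂ).re = ‖f u‖ ^ 2 := inner_self_eq_norm_sq (𝕜 := ℂ) _
    have h2 : ⟪f u, u⟫_ℂ = ⟪f u, f u⟫_ℂ := by
      conv_rhs => rw [← adjoint_inner_left, ← star_eq_adjoint, hfs]
      exact congr(⟪$hff.symm u, u⟫_ℂ)
    rw [sub_apply, inner_sub_left, smul_apply, inner_smul_left, Complex.sub_re,
      Complex.conj_ofReal, Complex.re_ofReal_mul, h2, h1]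
  have hauxM : ∀ t : ℝ, (b * f - (t : ℂ) • f) ∈ M := fun t =>
    sub_mem (mul_mem hbM hfM) (M.toStarSubalgebra.smul_mem hfM _)
  have haux : ∀ t : ℝ, ∀ u w, (⟪(b * f - (t : ℂ) • f) u, u⟫_ℂ).re < 0 →
      0 < (⟪(b * f - (t : ℂ) • f) w, w⟫_ℂ).re →
      ∃ g, IsProjectionIn M g ∧ g ≠ 0 ∧ g ≠ f ∧ f * g = g ∧ Commute g b := by
    intro t u w hu hw
    refine split_aux hb (hsa t) (hauxM t) ?_ ?_ ?_ hu hw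
    · rw [mul_sub, ← mul_assoc, hfb.eq, mul_assoc, hff, mul_smul_comm, hff]
    · rw [sub_mul, mul_assoc, hff, smul_mul_assoc, hff]
    · exact ((Commute.refl b).mul_left hfb).sub_left (hfb.smul_left _)
  set t := (⟪(b * f) v, v⟫_ℂ).re with ht
  by_cases h0 : b * f - (t : ℂ) • f = 0
  · rw [sub_eq_zero] at h0
    have := hM f
    simp only [IsMinimalProjectionIn, not_and, not_forall, not_or] at this
    obtain ⟨g, hg, hfg, hg0, hgf⟩ := this ⟨hfM, hfs, hff⟩ hf0
    refine ⟨g, hg, hg0, hgf, hfg, ?_⟩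
    have h1 : b * g = (t : ℂ) • g := by
      conv_lhs => rw [← hfg, ← mul_assoc, h0, smul_mul_assoc, hfg]
    have h2 := congr(star $h1)
    simp only [star_mul, star_smul, hg.2.1, hb, RCLike.star_def, Complex.conj_ofReal] at h2
    exact h2.trans h1.symm
  · obtain ⟨w, hw⟩ : ∃ w, (⟪(b * f - (t : ℂ) • f) w, w⟫_ℂ).re ≠ 0 := by
      by_contra! h
      apply h0
      have h3 : ((b * f - (t : ℂ) • f : H →L[ℂ] H) : H →ₗ[ℂ] H) = 0 := by
        rw [← inner_map_self_eq_zero]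
        intro u
        have h4 := (hsa t).isSymmetric.coe_re_inner_apply_self u
        rw [← h4]
        have h5 := h u
        exact (congrArg ((↑) : ℝ → ℂ) h5).trans Complex.ofReal_zero
      ext u
      exact congr($h3 u)
    have hwt := hq t w
    set δ := (⟪(b * f - (t : ℂ) • f) w, w⟫_ℂ).re with hδ
    set N := ‖f w‖ ^ 2 with hN
    have hN0 : 0 ≤ N := by positivity
    have hqv := hq (t + δ / (2 * (N + 1))) v
    have hqw := hq (t + δ / (2 * (N + 1))) w
    rw [← ht, hfv, hv1] at hqv
    have hqv' : t - (t + δ / (2 * (N + 1))) * 1 ^ 2 = - (δ / (2 * (N + 1))) := by ring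
    have hqw' : (⟪(b * f) w, w⟫_ℂ).re - (t + δ / (2 * (N + 1))) * N
        = δ * ((N + 2) / (2 * (N + 1))) := by
      rw [show (⟪(b * f) w, w⟫_ℂ).re = δ + t * N by linarith]
      field_simp
      ring
    have hp : 0 < (N + 2) / (2 * (N + 1)) := by positivity
    rcases lt_or_gt_of_ne hw with hlt | hgt
    · refine haux (t + δ / (2 * (N + 1))) w v ?_ ?_
      · rw [hqw, ← hN, hqw']; exact mul_neg_of_neg_of_pos hlt hp
      · rw [hqv, hqv', neg_pos]; exact div_neg_of_neg_of_pos hlt (by positivity)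
    · refine haux (t + δ / (2 * (N + 1))) v w ?_ ?_
      · rw [hqv, hqv', neg_lt_zero]; positivity
      · rw [hqw, ← hN, hqw']; positivity

theorem proj_norm_le {M : VonNeumannAlgebra H} {q : H →L[ℂ] H} (hq : IsProjectionIn M q) (ξ : H) :
    ‖q ξ‖ ≤ ‖ξ‖ := by
  have h : IsStarProjection q := ⟨hq.2.2, hq.2.1⟩
  exact (q.le_of_opNorm_le h.norm_le ξ).trans (by simp)

theorem proj_sub {M : VonNeumannAlgebra H} {p q : H →L[ℂ] H} (hp : IsProjectionIn M p)
    (hq : IsProjectionIn M q) (hpq : p * q = q) : IsProjectionIn M (p - q) := by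
  have hqp : q * p = q := by
    have := congr(star $hpq)
    simpa [hp.2.1, hq.2.1] using this
  refine ⟨sub_mem hp.1 hq.1, by rw [star_sub, hp.2.1, hq.2.1], ?_⟩
  rw [mul_sub, sub_mul, sub_mul, hp.2.2, hq.2.2, hpq, hqp]
  abel

theorem proj_pythag {M : VonNeumannAlgebra H} {q q₁ q₂ : H →L[ℂ] H} (hq₁ : IsProjectionIn M q₁)
    (hq : IsProjectionIn M q)
    (hq₂ : IsProjectionIn M q₂) (h₁ : q * q₁ = q₁) (h₂ : q * q₂ = q₂) (h : q₂ * q₁ = 0) (ξ : H) :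
    ‖q₁ ξ‖ ^ 2 + ‖q₂ ξ‖ ^ 2 ≤ ‖q ξ‖ ^ 2 := by
  have h12 : q₁ * q₂ = 0 := by
    have := congr(star $h)
    simpa [hq₁.2.1, hq₂.2.1] using this
  have h1' : q₁ * q = q₁ := by
    have := congr(star $h₁)
    simpa [hq₁.2.1, hq.2.1] using this
  have h2' : q₂ * q = q₂ := by
    have := congr(star $h₂)
    simpa [hq₂.2.1, hq.2.1] using this
  have hs : IsProjectionIn M (q₁ + q₂) := by
    refine ⟨add_mem hq₁.1 hq₂.1, by rw [star_add, hq₁.2.1, hq₂.2.1], ?_⟩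
    rw [mul_add, add_mul, add_mul, hq₁.2.2, hq₂.2.2, h, h12, add_zero, zero_add]
  have h3 : (q₁ + q₂) (q ξ) = q₁ ξ + q₂ ξ := by
    have : (q₁ + q₂) * q = q₁ + q₂ := by rw [add_mul, h1', h2']
    exact congr($this ξ)
  have h4 : ⟪q₁ ξ, q₂ ξ⟫_ℂ = 0 := by
    rw [← adjoint_inner_left, ← star_eq_adjoint, hq₂.2.1]
    have : q₂ (q₁ ξ) = 0 := congr($h ξ)
    rw [this, inner_zero_left]
  have h5 := norm_add_sq_eq_norm_sq_add_norm_sq_of_inner_eq_zero _ _ h4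
  have h6 := proj_norm_le hs (q ξ)
  rw [h3] at h6
  have h7 := mul_self_le_mul_self (norm_nonneg _) h6
  rw [h5] at h7
  simpa [sq] using h7

theorem halving {M : VonNeumannAlgebra H} (hM : M.Atomless) {e p : H →L[ℂ] H}
    (he : IsProjectionIn M e) (he0 : e ≠ 0) (hp : IsProjectionIn M p) (ξ : H) (n : ℕ) :
    ∃ f q, IsProjectionIn M f ∧ f ≠ 0 ∧ e * f = f ∧ Commute f (e * p * e) ∧
      IsProjectionIn M q ∧ IsRangeProj (p * f) q ∧ ‖q ξ‖ ^ 2 ≤ ‖ξ‖ ^ 2 * (1 / 2) ^ n := by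
  induction n with
  | zero =>
    obtain ⟨q, hq, hr⟩ := exists_rangeProj M (p * e) (mul_mem hp.1 he.1)
    refine ⟨e, q, he, he0, he.2.2, ?_, hq, hr, ?_⟩
    · change e * (e * p * e) = e * p * e * e
      rw [mul_assoc _ e e, he.2.2, ← mul_assoc, ← mul_assoc, he.2.2]
    · simpa using pow_le_pow_left₀ (norm_nonneg _) (proj_norm_le hq ξ) 2
  | succ n ih =>
    obtain ⟨f, q, hf, hf0, hef, hfb, hq, hr, hle⟩ := ih
    have hb : star (e * p * e) = e * p * e := by
      simp [he.2.1, hp.2.1, mul_assoc]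
    have hbM : e * p * e ∈ M := mul_mem (mul_mem he.1 hp.1) he.1
    obtain ⟨g, hg, hg0, hgf, hfg, hgb⟩ := split hM hf hf0 hb hbM hfb
    have hh : IsProjectionIn M (f - g) := proj_sub hf hg hfg
    have hh0 : f - g ≠ 0 := sub_ne_zero.2 hgf.symm
    have hfh : f * (f - g) = f - g := by rw [mul_sub, hf.2.2, hfg]
    have hhb : Commute (f - g) (e * p * e) := hfb.sub_left hgb
    have hgf' : g * f = g := by
      have := congr(star $hfg)
      simpa [hf.2.1, hg.2.1] using this
    have hgh : g * (f - g) = 0 := by rw [mul_sub, hgf', hg.2.2, sub_self]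
    obtain ⟨q₁, hq₁, hr₁⟩ := exists_rangeProj M (p * g) (mul_mem hp.1 hg.1)
    obtain ⟨q₂, hq₂, hr₂⟩ := exists_rangeProj M (p * (f - g)) (mul_mem hp.1 hh.1)
    have hsub : ∀ s q', f * s = s → IsRangeProj (p * s) q' → q * q' = q' := by
      intro s q' hs hr'
      have h1 : (q - 1) * (p * s) = 0 := by
        rw [← hs, ← mul_assoc p, ← mul_assoc, sub_mul, hr.1, one_mul, sub_self, zero_mul]
      have := hr'.2 _ h1
      rwa [sub_mul, one_mul, sub_eq_zero] at this
    have heg : e * g = g := by rw [← hfg, ← mul_assoc, hef]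
    have hge : g * e = g := by
      have := congr(star $heg)
      simpa [he.2.1, hg.2.1] using this
    have heh : e * (f - g) = f - g := by rw [mul_sub, hef, heg]
    have horth : q₂ * q₁ = 0 := by
      have h1 : g * p * (p * (f - g)) = 0 := by
        calc g * p * (p * (f - g)) = g * (p * p) * (f - g) := by simp only [mul_assoc]
          _ = g * p * (f - g) := by rw [hp.2.2]
          _ = (g * e) * p * (e * (f - g)) := by rw [hge, heh]
          _ = (g * (e * p * e)) * (f - g) := by simp only [mul_assoc]
          _ = (e * p * e) * (g * (f - g)) := by rw [hgb.eq, mul_assoc]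
          _ = 0 := by rw [hgh, mul_zero]
      have h2 := congr(star $(hr₂.2 _ h1))
      have h3 : q₂ * (p * g) = 0 := by
        simpa [hq₂.2.1, hp.2.1, hg.2.1] using h2
      exact hr₁.2 _ h3
    have hpy := proj_pythag hq₁ hq hq₂ (hsub _ _ hfg hr₁) (hsub _ _ hfh hr₂) horth ξ
    rcases le_total (‖q₁ ξ‖ ^ 2) (‖q₂ ξ‖ ^ 2) with h | h
    · exact ⟨g, q₁, hg, hg0, heg, hgb, hq₁, hr₁, by rw [pow_succ (1 / 2 : ℝ)]; linarith⟩
    · exact ⟨f - g, q₂, hh, hh0, heh, hhb, hq₂, hr₂, by rw [pow_succ (1 / 2 : ℝ)]; linarith⟩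

theorem step {M : VonNeumannAlgebra H} (hM : M.Atomless) {e p : H →L[ℂ] H}
    (he : IsProjectionIn M e) (he0 : e ≠ 0) (hp : IsProjectionIn M p) (ξ : H) (η : ℝ)
    (hη : 0 < η) :
    ∃ p', IsProjectionIn M p' ∧ p * p' = p' ∧ ‖p ξ - p' ξ‖ ≤ η ∧
      ∃ v, e v = v ∧ ‖v‖ = 1 ∧ p' v = 0 := by
  obtain ⟨n, hn⟩ : ∃ n : ℕ, ‖ξ‖ ^ 2 * (1 / 2) ^ n < η ^ 2 := by
    have h1 : Filter.Tendsto (fun n : ℕ => ‖ξ‖ ^ 2 * (1 / 2 : ℝ) ^ n) Filter.atTop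
        (nhds (‖ξ‖ ^ 2 * 0)) :=
      (tendsto_pow_atTop_nhds_zero_of_lt_one (by norm_num) (by norm_num)).const_mul _
    rw [mul_zero] at h1
    exact (h1.eventually (gt_mem_nhds (by positivity : (0 : ℝ) < η ^ 2))).exists
  obtain ⟨f, q, hf, hf0, hef, -, hq, hr, hle⟩ := halving hM he he0 hp ξ n
  have hpq : p * q = q := by
    have h1 : (p - 1) * (p * f) = 0 := by
      rw [← mul_assoc, sub_mul, hp.2.2, one_mul, sub_self, zero_mul]
    have := hr.2 _ h1
    rwa [sub_mul, one_mul, sub_eq_zero] at this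
  have hqp : q * p = q := by
    have := congr(star $hpq)
    simpa [hp.2.1, hq.2.1] using this
  refine ⟨p - q, proj_sub hp hq hpq, by rw [mul_sub, hp.2.2, hpq], ?_, ?_⟩
  · have : p ξ - (p - q) ξ = q ξ := by simp
    rw [this]
    exact le_of_sq_le_sq (hle.trans hn.le) hη.le
  · obtain ⟨v, hv, hv1⟩ := exists_fixed hf hf0
    refine ⟨v, ?_, hv1, ?_⟩
    · have := congr($hef v)
      simpa [hv] using this
    · have h1 : (p - q) * f = 0 := by
        have h2 := hr.1
        rw [← mul_assoc, hqp] at h2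
        rw [sub_mul, h2, sub_self]
      have := congr($h1 v)
      simpa [hv] using this

theorem exists_common [Nontrivial H] {M : VonNeumannAlgebra H} (hM : M.Atomless)
    (e : ℕ → H →L[ℂ] H) (he : ∀ j, IsProjectionIn M (e j)) (he0 : ∀ j, e j ≠ 0) :
    ∃ x ∈ M, ‖x‖ = 1 ∧ ∀ j, ∃ v, e j v = v ∧ ‖v‖ = 1 ∧ x v = 0 := by
  obtain ⟨ξ, hξ⟩ : ∃ ξ : H, ‖ξ‖ = 1 := by
    obtain ⟨v, -, hv⟩ := exists_fixed (one_proj M) one_ne_zero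
    exact ⟨v, hv⟩
  choose! F hF1 hF2 hF3 hF4 using fun (j : ℕ) (p : H →L[ℂ] H) (hp : IsProjectionIn M p) =>
    step hM (he j) (he0 j) hp ξ (1 / 4 * (1 / 2) ^ j) (by positivity)
  let P : ℕ → H →L[ℂ] H := fun n => Nat.rec 1 (fun j p => F j p) n
  have hP0 : P 0 = 1 := rfl
  have hPs : ∀ j, P (j + 1) = F j (P j) := fun j => rfl
  have hP : ∀ j, IsProjectionIn M (P j) := by
    intro j
    induction j with
    | zero => exact one_proj M
    | succ j ih => rw [hPs]; exact hF1 j _ ih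
  have hmono : ∀ i k, P i * P (i + k) = P (i + k) := by
    intro i k
    induction k with
    | zero => exact (hP i).2.2
    | succ k ih =>
      have h1 : P (i + k) * P (i + (k + 1)) = P (i + (k + 1)) := hF2 (i + k) _ (hP _)
      rw [← h1, ← mul_assoc, ih]
  have hdist : ∀ j, dist (P j ξ) (P (j + 1) ξ) ≤ 1 / 4 * (1 / 2) ^ j := by
    intro j
    rw [dist_eq_norm]
    exact hF3 j _ (hP j)
  obtain ⟨ζ, hζ⟩ := cauchySeq_tendsto_of_complete
    (cauchySeq_of_le_geometric (1 / 2) (1 / 4) (by norm_num) hdist)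
  have hζ0 : ζ ≠ 0 := by
    rintro rfl
    have := dist_le_of_le_geometric_of_tendsto₀ (1 / 2) (1 / 4) (by norm_num) hdist hζ
    rw [hP0] at this
    simp [hξ] at this
    norm_num at this
  have hζP : ∀ i, P i ζ = ζ := by
    intro i
    have h1 : Filter.Tendsto (fun n => P i (P (n + i) ξ)) Filter.atTop (nhds (P i ζ)) :=
      ((P i).continuous.tendsto ζ).comp (hζ.comp (Filter.tendsto_add_atTop_nat i))
    have h2 : Filter.Tendsto (fun n => P (n + i) ξ) Filter.atTop (nhds ζ) :=
      hζ.comp (Filter.tendsto_add_atTop_nat i)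
    have h3 : (fun n => P i (P (n + i) ξ)) = fun n => P (n + i) ξ := by
      funext n
      have := hmono i n
      rw [add_comm] at this
      exact congr($this ξ)
    rw [h3] at h1
    exact tendsto_nhds_unique h1 h2
  let K : Submodule ℂ H := ⨅ i, (P i - 1).ker
  have hKmem : ∀ v, v ∈ K ↔ ∀ i, P i v = v := by
    intro v
    simp [K, Submodule.mem_iInf, sub_eq_zero]
  have hKc : IsClosed (K : Set H) := by
    simp only [K, Submodule.coe_iInf]
    exact isClosed_iInter fun i => (P i - 1).isClosed_ker
  have : CompleteSpace K := hKc.completeSpace_coe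
  have hx := proj_of_invariant M K (by
    intro y hy v hv
    rw [hKmem] at hv ⊢
    intro i
    have h1 := congr($((commute_commutant M (hP i).1 hy).eq) v)
    have h2 : P i (y v) = y (P i v) := h1
    rw [h2, hv i])
  refine ⟨K.starProjection, hx.1, ?_, ?_⟩
  · refine le_antisymm K.starProjection_norm_le ?_
    have h1 := K.starProjection.le_opNorm ζ
    rw [Submodule.starProjection_eq_self_iff.2 ((hKmem ζ).2 hζP)] at h1
    exact (le_mul_iff_one_le_left (norm_pos_iff.2 hζ0)).1 h1
  · intro j
    obtain ⟨v, hv, hv1, hv0⟩ := hF4 j _ (hP j)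
    refine ⟨v, hv, hv1, ?_⟩
    have h1 : P (j + 1) * K.starProjection = K.starProjection := by
      ext u
      exact (hKmem _).1 (K.starProjection_apply_mem u) (j + 1)
    have h2 := congr(star $h1)
    rw [star_mul, hx.2.1, (hP (j + 1)).2.1] at h2
    rw [← h2]
    change K.starProjection (F j (P j) v) = 0
    rw [hv0, map_zero]

/-- **Theorem 3.5.** A nontrivial atomless von Neumann algebra fails the
ball-covering property. -/
theorem atomless_not_BCP [Nontrivial H]
    (M : VonNeumannAlgebra H) (hM : M.Atomless) :
    ¬ HasBCPOn (M : Set (H →L[ℂ] H)) := by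
  rintro ⟨c, r, hc, hr, hcov⟩
  choose E hE hE0 hEb using fun (n k : ℕ) =>
    exists_spectral_s5 M (c n) (hc n) (1 / ((k : ℝ) + 1)) (by positivity)
  obtain ⟨x, hxM, hx1, hx⟩ := exists_common hM (fun j => E j.unpair.1 j.unpair.2)
    (fun j => hE _ _) (fun j => hE0 _ _)
  obtain ⟨n, hn⟩ := hcov x hxM hx1
  have hlt : ‖x - c n‖ < ‖c n‖ := hn.trans_le (hr n)
  obtain ⟨k, hk⟩ := exists_nat_one_div_lt (sub_pos.2 hlt)
  obtain ⟨v, hv, hv1, hv0⟩ := hx (Nat.pair n k)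
  simp only [Nat.unpair_pair] at hv
  have h1 := hEb n k v hv
  have h2 := (x - c n).le_opNorm v
  rw [sub_apply, hv0, zero_sub, norm_neg, hv1, mul_one] at h2
  rw [hv1, mul_one] at h1
  linarith
end
end

section
/- Let H be a nontrivial complex Hilbert space and let M be an atomless, semifinite von Neumann algebra on H. Then the compact ideal J(M), regarded as a normed space with the operator norm, does not have the ball-covering property. -/
noncomputable section

variable {H : Type*} [NormedAddCommGroup H] [InnerProductSpace ℂ H] [CompleteSpace H]

/-- `p` is a finite projection of `M` in the Murray–von Neumann sense. -/
def IsFiniteProjectionIn (M : VonNeumannAlgebra H) (p : H →L[ℂ] H) : Prop :=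
  IsProjectionIn M p ∧
    ∀ q, IsProjectionIn M q → p * q = q →
      (∃ v ∈ M, star v * v = p ∧ v * star v = q) → q = p

/-- `M` is semifinite: every nonzero projection of `M` dominates a nonzero finite
projection of `M`. -/
def VonNeumannAlgebra.Semifinite (M : VonNeumannAlgebra H) : Prop :=
  ∀ p, IsProjectionIn M p → p ≠ 0 →
    ∃ q, IsFiniteProjectionIn M q ∧ q ≠ 0 ∧ p * q = q

/-- The compact ideal `J(M)`: the operator-norm closure of the linear span of
`{a ∘ p ∘ b : a, b ∈ M, p a finite projection of M}`. -/
def compactIdeal (M : VonNeumannAlgebra H) : Set (H →L[ℂ] H) :=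
  closure (Submodule.span ℂ
    {x : H →L[ℂ] H | ∃ a b p, a ∈ M ∧ b ∈ M ∧ IsFiniteProjectionIn M p ∧ x = a * p * b} :
    Set (H →L[ℂ] H))

theorem aux_mem_of_commutant (M : VonNeumannAlgebra H) (b : H →L[ℂ] H)
    (h : ∀ u ∈ M.commutant, u * b = b * u) : b ∈ M := by
  rw [← VonNeumannAlgebra.commutant_commutant M, VonNeumannAlgebra.mem_commutant_iff]
  exact h

theorem aux_smul_mem (M : VonNeumannAlgebra H) (z : ℂ) {b : H →L[ℂ] H} (hb : b ∈ M) :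
    z • b ∈ M := M.toStarSubalgebra.smul_mem hb z

/-- The compact ideal lies in `M`. -/
theorem aux_compactIdeal_sub (M : VonNeumannAlgebra H) {c : H →L[ℂ] H}
    (hc : c ∈ compactIdeal M) : c ∈ M := by
  have hcl : IsClosed (M : Set (H →L[ℂ] H)) := by
    rw [← VonNeumannAlgebra.centralizer_centralizer M]
    exact Set.isClosed_centralizer _
  have hsub : (Submodule.span ℂ
    {x : H →L[ℂ] H | ∃ a b p, a ∈ M ∧ b ∈ M ∧ IsFiniteProjectionIn M p ∧ x = a * p * b} :
    Set (H →L[ℂ] H)) ⊆ M := by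
    intro x hx
    have : x ∈ Subalgebra.toSubmodule M.toStarSubalgebra.toSubalgebra := by
      refine Submodule.span_le.2 ?_ hx
      rintro x ⟨a, b, p, ha, hb, hp, rfl⟩
      exact mul_mem (S := VonNeumannAlgebra H) (mul_mem ha hp.1.1) hb
    exact this
  exact closure_minimal hsub hcl hc

/-- Projection onto a closed subspace invariant under the commutant. -/
theorem aux_proj (M : VonNeumannAlgebra H) (K : Submodule ℂ H) [K.HasOrthogonalProjection]
    (h : ∀ u ∈ M.commutant, ∀ x ∈ K, u x ∈ K) : IsProjectionIn M K.starProjection := by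
  have hp : IsStarProjection K.starProjection := isStarProjection_starProjection
  refine ⟨?_, hp.isSelfAdjoint, hp.isIdempotentElem⟩
  rw [VonNeumannAlgebra.IsStarProjection.mem_iff hp]
  intro y hy
  rw [Submodule.range_starProjection]
  exact fun x hx => h y hy x hx

theorem aux_spectral [Nontrivial H] (M : VonNeumannAlgebra H) {c : H →L[ℂ] H} (hc : c ∈ M)
    {ε : ℝ} (hε : 0 < ε) : ∃ p, IsProjectionIn M p ∧ p ≠ 0 ∧
      ∀ z, p z = z → (‖c‖ - ε) * ‖z‖ ≤ ‖c z‖ := by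
  by_cases hce : ‖c‖ ≤ ε
  · refine ⟨1, ⟨one_mem M, star_one _, one_mul _⟩, one_ne_zero, fun z _ => ?_⟩
    nlinarith [norm_nonneg z, norm_nonneg (c z)]
  push Not at hce
  set r := ‖c‖ - ε with hr
  have hr0 : 0 < r := by linarith
  have hrc : r < ‖c‖ := by linarith
  set A : H →L[ℂ] H := star c * c - algebraMap ℝ (H →L[ℂ] H) (r ^ 2) with hA
  have hAsa : IsSelfAdjoint A :=
    (IsSelfAdjoint.star_mul_self c).sub (IsSelfAdjoint.algebraMap _ (IsSelfAdjoint.all _))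
  have hcomm : ∀ u ∈ M.commutant, Commute u A := by
    intro u hu
    rw [VonNeumannAlgebra.mem_commutant_iff] at hu
    refine Commute.sub_right (hu _ (mul_mem (star_mem hc) hc)).symm ?_
    exact (Algebra.commutes (r ^ 2) u).symm
  have hneg : ∀ u ∈ M.commutant, Commute u A⁻ := by
    intro u hu
    rw [CFC.negPart_def]
    refine (Commute.cfcₙ_real ?_ _).symm
    exact (hcomm u hu).symm
  have hpos : A⁺ ≠ 0 := by
    intro h0
    have h1 := (CFC.posPart_eq_zero_iff A hAsa).1 h0
    have h2 : star c * c ≤ algebraMap ℝ (H →L[ℂ] H) (r ^ 2) := sub_nonpos.1 h1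
    have h3 := (CStarAlgebra.norm_le_iff_le_algebraMap (star c * c) (sq_nonneg r)
      (star_mul_self_nonneg c)).2 h2
    rw [CStarRing.norm_star_mul_self] at h3
    nlinarith
  have : CompleteSpace (LinearMap.ker (A⁻ : H →L[ℂ] H).toLinearMap) :=
    (ContinuousLinearMap.isClosed_ker (A⁻ : H →L[ℂ] H)).completeSpace_coe
  have hinv : ∀ u ∈ M.commutant, ∀ x ∈ LinearMap.ker (A⁻ : H →L[ℂ] H).toLinearMap,
      u x ∈ LinearMap.ker (A⁻ : H →L[ℂ] H).toLinearMap := by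
    intro u hu x hx
    have h1 : A⁻ x = 0 := hx
    have h2 : u (A⁻ x) = A⁻ (u x) := congrArg (fun T : H →L[ℂ] H => T x) (hneg u hu)
    change A⁻ (u x) = 0
    rw [← h2, h1, map_zero]
  refine ⟨_, aux_proj M _ hinv, ?_, ?_⟩
  · intro h0
    apply hpos
    ext x
    have h1 : A⁺ x ∈ LinearMap.ker (A⁻ : H →L[ℂ] H).toLinearMap :=
      congrArg (fun T : H →L[ℂ] H => T x) (CFC.negPart_mul_posPart A)
    have h2 := Submodule.starProjection_eq_self_iff.2 h1
    rw [h0] at h2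
    simpa using h2.symm
  · intro z hz
    have hz' : A⁻ z = 0 := Submodule.starProjection_eq_self_iff.1 hz
    have h1 : A z = A⁺ z := by
      conv_lhs => rw [← CFC.posPart_sub_negPart A hAsa]
      simp [hz']
    have h2 : 0 ≤ RCLike.re (inner ℂ (A⁺ z) z) :=
      ((ContinuousLinearMap.nonneg_iff_isPositive _).1 (CFC.posPart_nonneg A)).re_inner_nonneg_left z
    rw [← h1] at h2
    have h3 : A z = ContinuousLinearMap.adjoint c (c z) - ((r ^ 2 : ℝ) : ℂ) • z := by
      rw [Complex.coe_smul]
      simp [hA, Algebra.algebraMap_eq_smul_one, ContinuousLinearMap.star_eq_adjoint]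
    rw [h3, inner_sub_left, ContinuousLinearMap.adjoint_inner_left, inner_smul_left,
      map_sub, inner_self_eq_norm_sq, Complex.conj_ofReal] at h2
    have h4 : RCLike.re (((r ^ 2 : ℝ) : ℂ) * inner ℂ z z) = r ^ 2 * ‖z‖ ^ 2 := by
      rw [← inner_self_eq_norm_sq (𝕜 := ℂ) z]
      exact Complex.re_ofReal_mul _ _
    rw [h4] at h2
    refine le_of_sq_le_sq ?_ (norm_nonneg _)
    nlinarith

theorem aux_proj_norm {M : VonNeumannAlgebra H} {q : H →L[ℂ] H} (hq : IsProjectionIn M q) (x : H) :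
    ‖q x‖ ^ 2 = RCLike.re (inner ℂ (q x) x) := by
  have h1 : inner ℂ (q x) (q x) = inner ℂ (q x) x := by
    have : inner ℂ (star q (q x)) x = inner ℂ (q x) (q x) := by
      rw [ContinuousLinearMap.star_eq_adjoint, ContinuousLinearMap.adjoint_inner_left]
    rw [← this, hq.2.1, ← mul_apply_eq_comp, hq.2.2]
  rw [← inner_self_eq_norm_sq (𝕜 := ℂ), h1]

theorem aux_halve (M : VonNeumannAlgebra H) (hM : M.Atomless) (x : H) (n : ℕ) :
    ∀ p, IsProjectionIn M p → p ≠ 0 →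
    ∃ q, IsProjectionIn M q ∧ q ≠ 0 ∧ p * q = q ∧ ‖q x‖ ^ 2 ≤ ‖p x‖ ^ 2 / 2 ^ n := by
  induction n with
  | zero => exact fun p hp h0 => ⟨p, hp, h0, hp.2.2, by simp⟩
  | succ n ih =>
    intro p hp h0
    obtain ⟨q, hq, hq0, hpq, hle⟩ := ih p hp h0
    have hnm := hM q
    unfold IsMinimalProjectionIn at hnm
    push Not at hnm
    obtain ⟨s, hs, hqs, hs0, hsq⟩ := hnm hq hq0
    have hsq' : s * q = s := by
      have := congrArg star hqs
      rwa [star_mul, hs.2.1, hq.2.1] at this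
    have ht : IsProjectionIn M (q - s) := by
      refine ⟨sub_mem hq.1 hs.1, by rw [star_sub, hq.2.1, hs.2.1], ?_⟩
      rw [sub_mul, mul_sub, mul_sub, hq.2.2, hqs, hsq', hs.2.2]; abel
    have hsum : ‖s x‖ ^ 2 + ‖(q - s) x‖ ^ 2 = ‖q x‖ ^ 2 := by
      rw [aux_proj_norm hs, aux_proj_norm ht, aux_proj_norm hq, sub_apply,
        inner_sub_left, map_sub]; ring
    have hpow : ‖p x‖ ^ 2 / 2 ^ (n + 1) = ‖p x‖ ^ 2 / 2 ^ n / 2 := by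
      rw [pow_succ 2 n, div_div]
    rcases le_total (‖s x‖ ^ 2) (‖(q - s) x‖ ^ 2) with h | h
    · refine ⟨s, hs, hs0, ?_, by rw [hpow]; linarith⟩
      rw [← hqs, ← mul_assoc, hpq]
    · refine ⟨q - s, ht, sub_ne_zero.2 (Ne.symm hsq), ?_, by rw [hpow]; linarith⟩
      rw [mul_sub, hpq, ← hqs, ← mul_assoc, hpq]

theorem aux_small (M : VonNeumannAlgebra H) (hM : M.Atomless) (x : H) {δ : ℝ} (hδ : 0 < δ)
    {p : H →L[ℂ] H} (hp : IsProjectionIn M p) (h0 : p ≠ 0) :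
    ∃ q, IsProjectionIn M q ∧ q ≠ 0 ∧ p * q = q ∧ ‖q x‖ ^ 2 ≤ δ := by
  have ht : Filter.Tendsto (fun n : ℕ => ‖p x‖ ^ 2 * (1 / 2 : ℝ) ^ n) Filter.atTop (nhds 0) := by
    simpa using (tendsto_pow_atTop_nhds_zero_of_lt_one (r := (1 / 2 : ℝ)) (by norm_num)
      (by norm_num)).const_mul (‖p x‖ ^ 2)
  obtain ⟨n, hn⟩ := (ht.eventually (gt_mem_nhds hδ)).exists
  obtain ⟨q, h1, h2, h3, h4⟩ := aux_halve M hM x n p hp h0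
  refine ⟨q, h1, h2, h3, h4.trans ?_⟩
  rw [div_eq_mul_inv, ← inv_pow, ← one_div]
  exact hn.le

theorem auxDiag_memℓp (u : H →L[ℂ] H) (f : lp (fun _ : ℕ => H) 2) :
    Memℓp (E := fun _ : ℕ => H) (fun i => u (f i)) 2 := by
  have h1 : Summable fun i => ‖f i‖ ^ 2 := by
    simpa using (lp.memℓp f).summable (by simp)
  refine memℓp_gen ?_
  simp only [ENNReal.toReal_ofNat, Real.rpow_ofNat]
  refine Summable.of_nonneg_of_le (fun _ => by positivity) (fun i => ?_) (h1.mul_left (‖u‖ ^ 2))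
  rw [← mul_pow]
  exact pow_le_pow_left₀ (norm_nonneg _) (u.le_opNorm (f i)) 2

/-- Diagonal action on `ℓ²(ℕ, H)`. -/
def auxDiag (u : H →L[ℂ] H) (f : lp (fun _ : ℕ => H) 2) : lp (fun _ : ℕ => H) 2 :=
  ⟨fun i => u (f i), auxDiag_memℓp u f⟩

theorem auxDiag_inner (u : H →L[ℂ] H) (f g : lp (fun _ : ℕ => H) 2) :
    inner ℂ (auxDiag u f) g = inner ℂ f (auxDiag (star u) g) := by
  rw [lp.inner_eq_tsum, lp.inner_eq_tsum]
  refine tsum_congr fun i => ?_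
  change inner ℂ (u (f i)) (g i) = inner ℂ (f i) (star u (g i))
  rw [ContinuousLinearMap.star_eq_adjoint, ContinuousLinearMap.adjoint_inner_right]

/-- Evaluation on `ℓ²(ℕ, H)`. -/
abbrev auxEv (i : ℕ) : lp (fun _ : ℕ => H) 2 →L[ℂ] H := lp.evalCLM ℂ (fun _ : ℕ => H) 2 i

/-- The graph subspace. -/
def auxW (q : ℕ → H →L[ℂ] H) : Submodule ℂ (lp (fun _ : ℕ => H) 2) :=
  ⨅ m : ℕ, LinearMap.ker
    (auxEv (m + 1) - ((m : ℂ) + 1) • (q m).comp (auxEv 0) : lp (fun _ : ℕ => H) 2 →L[ℂ] H).toLinearMap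

theorem auxW_mem (q : ℕ → H →L[ℂ] H) (f : lp (fun _ : ℕ => H) 2) :
    f ∈ auxW q ↔ ∀ m : ℕ, f (m + 1) = ((m : ℂ) + 1) • q m (f 0) := by
  simp only [auxW, Submodule.mem_iInf]
  refine forall_congr' fun m => ?_
  exact sub_eq_zero

instance auxW_complete (q : ℕ → H →L[ℂ] H) : CompleteSpace (auxW q) := by
  have : IsClosed (auxW q : Set (lp (fun _ : ℕ => H) 2)) := by
    rw [auxW, Submodule.coe_iInf]
    exact isClosed_iInter fun m => ContinuousLinearMap.isClosed_ker _
  exact this.completeSpace_coe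

/-- The operator `(1 + Σ (m+1)² q_m)⁻¹`. -/
def auxY (q : ℕ → H →L[ℂ] H) : H →L[ℂ] H :=
  (auxEv 0).comp ((auxW q).starProjection.comp
    (lp.singleContinuousLinearMap ℂ (fun _ : ℕ => H) 2 0))

theorem auxY_apply (q : ℕ → H →L[ℂ] H) (x : H) :
    auxY q x = (auxW q).starProjection (lp.single 2 0 x) 0 := rfl

theorem auxY_inner (q : ℕ → H →L[ℂ] H) (x z : H) :
    inner ℂ (auxY q x) z = inner ℂ ((auxW q).starProjection (lp.single 2 0 x)) (lp.single 2 0 z) := by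
  rw [auxY_apply, lp.inner_single_right]

theorem auxY_star (q : ℕ → H →L[ℂ] H) : star (auxY q) = auxY q := by
  rw [ContinuousLinearMap.star_eq_adjoint]
  symm
  rw [ContinuousLinearMap.eq_adjoint_iff]
  intro x z
  rw [auxY_inner, Submodule.inner_starProjection_left_eq_right, auxY_apply, lp.inner_single_left]

theorem auxY_mem (M : VonNeumannAlgebra H) (q : ℕ → H →L[ℂ] H) (hq : ∀ m, q m ∈ M) :
    auxY q ∈ M := by
  have hW : ∀ u ∈ M.commutant, ∀ f ∈ auxW q, auxDiag u f ∈ auxW q := by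
    intro u hu f hf
    rw [auxW_mem] at hf ⊢
    intro m
    change u (f (m + 1)) = _ • q m (u (f 0))
    rw [hf m, map_smul]
    congr 1
    exact (congrArg (fun T : H →L[ℂ] H => T (f 0))
      (VonNeumannAlgebra.mem_commutant_iff.1 hu _ (hq m))).symm
  refine aux_mem_of_commutant M _ fun u hu => ?_
  ext x
  change u (auxY q x) = auxY q (u x)
  rw [auxY_apply, auxY_apply]
  have key : (auxW q).starProjection (lp.single 2 0 (u x)) =
      auxDiag u ((auxW q).starProjection (lp.single 2 0 x)) := by
    refine Submodule.eq_starProjection_of_mem_of_inner_eq_zero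
      (hW u hu _ (Submodule.starProjection_apply_mem _ _)) ?_
    intro w hw
    have h1 : (lp.single 2 0 (u x) : lp (fun _ : ℕ => H) 2) = auxDiag u (lp.single 2 0 x) := by
      ext i
      change (lp.single 2 0 (u x) : lp (fun _ : ℕ => H) 2) i =
        u ((lp.single 2 0 x : lp (fun _ : ℕ => H) 2) i)
      rcases eq_or_ne i 0 with rfl | h
      · simp
      · simp [h]
    rw [h1, inner_sub_left, auxDiag_inner, auxDiag_inner, ← inner_sub_left]
    exact Submodule.starProjection_inner_eq_zero _ _ (hW _ (star_mem hu) _ hw)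
  rw [key]
  rfl

theorem auxY_bound (q : ℕ → H →L[ℂ] H) (m : ℕ) : ‖q m * auxY q‖ ≤ 1 / ((m : ℝ) + 1) := by
  refine ContinuousLinearMap.opNorm_le_bound _ (by positivity) fun x => ?_
  set f := (auxW q).starProjection (lp.single 2 0 x) with hf
  have h1 := (auxW_mem q f).1 (Submodule.starProjection_apply_mem _ _) m
  have hs : ‖(lp.single 2 0 x : lp (fun _ : ℕ => H) 2)‖ = ‖x‖ :=
    lp.norm_single (E := fun _ : ℕ => H) (p := 2) zero_lt_two 0 x
  have h2 : ‖f (m + 1)‖ ≤ ‖x‖ :=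
    (lp.norm_apply_le_norm (by simp) f (m + 1)).trans
      ((Submodule.norm_starProjection_apply_le _ _).trans hs.le)
  have h3 : ‖((m : ℂ) + 1)‖ = (m : ℝ) + 1 := by
    have := Complex.norm_natCast (m + 1)
    push_cast at this
    exact this
  rw [h1, norm_smul, h3] at h2
  change ‖q m (f 0)‖ ≤ _
  have : (0 : ℝ) < m + 1 := by positivity
  rw [div_mul_eq_mul_div, one_mul, le_div_iff₀ this]
  linarith

theorem auxY_ne (q : ℕ → H →L[ℂ] H) {x : H} (hx : x ≠ 0)
    (h : ∀ m : ℕ, ‖q m x‖ ^ 2 ≤ (1 / 2) ^ m / ((m : ℝ) + 1) ^ 2) : inner ℂ (auxY q x) x ≠ 0 := by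
  let F : ℕ → H := fun i => Nat.casesOn i x fun m => ((m : ℂ) + 1) • q m x
  have hF : Memℓp (E := fun _ : ℕ => H) F 2 := by
    refine memℓp_gen ?_
    simp only [ENNReal.toReal_ofNat, Real.rpow_ofNat]
    rw [← summable_nat_add_iff 1]
    refine Summable.of_nonneg_of_le (fun _ => by positivity) (fun m => ?_)
      (summable_geometric_of_lt_one (r := (1 / 2 : ℝ)) (by norm_num) (by norm_num))
    change ‖((m : ℂ) + 1) • q m x‖ ^ 2 ≤ _
    have h3 : ‖((m : ℂ) + 1)‖ = (m : ℝ) + 1 := by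
      have := Complex.norm_natCast (m + 1)
      push_cast at this
      exact this
    have h4 := h m
    rw [le_div_iff₀ (by positivity)] at h4
    rw [norm_smul, h3, mul_pow]
    linarith
  let f : lp (fun _ : ℕ => H) 2 := ⟨F, hF⟩
  have hfW : f ∈ auxW q := (auxW_mem q f).2 fun m => rfl
  intro h0
  have h1 : (auxW q).starProjection (lp.single 2 0 x) = 0 := by
    have := Submodule.re_inner_starProjection_eq_normSq (𝕜 := ℂ) (K := auxW q) (lp.single 2 0 x)
    rw [← auxY_inner, h0] at this
    simpa using this.symm
  have h2 : inner ℂ f (lp.single 2 0 x) = 0 := by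
    rw [← Submodule.starProjection_eq_self_iff.2 hfW, Submodule.inner_starProjection_left_eq_right,
      h1, inner_zero_right]
  rw [lp.inner_single_right] at h2
  exact hx (inner_self_eq_zero.1 h2)

/-- **Corollary 3.6.** The compact ideal `J(M)` of an atomless semifinite
von Neumann algebra on a nontrivial Hilbert space fails the ball-covering property. -/
theorem compactIdeal_not_BCP [Nontrivial H]
    (M : VonNeumannAlgebra H) (hM : M.Atomless) (hsf : M.Semifinite) :
    ¬ HasBCPOn (compactIdeal M) := by
  rintro ⟨c, r, hc, hr, hcov⟩
  obtain ⟨e, he, he0, -⟩ := hsf 1 ⟨one_mem M, star_one _, one_mul _⟩ one_ne_zero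
  obtain ⟨x, hx⟩ : ∃ x, e x ≠ 0 := by
    by_contra! h
    exact he0 (ContinuousLinearMap.ext h)
  have hee : e (e x) = e x := congrArg (fun T : H →L[ℂ] H => T x) he.1.2.2
  set w := e x with hw
  -- choose spectral projections
  have hP : ∀ m : ℕ, ∃ p, IsProjectionIn M p ∧ p ≠ 0 ∧
      ∀ z, p z = z → (‖c m.unpair.1‖ - 1 / ((m.unpair.2 : ℝ) + 1)) * ‖z‖ ≤ ‖c m.unpair.1 z‖ :=
    fun m => aux_spectral M (aux_compactIdeal_sub M (hc _)) (by positivity)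
  choose p hp hp0 hpc using hP
  have hQ : ∀ m : ℕ, ∃ q, IsProjectionIn M q ∧ q ≠ 0 ∧ p m * q = q ∧
      ‖q w‖ ^ 2 ≤ (1 / 2) ^ m / ((m : ℝ) + 1) ^ 2 :=
    fun m => aux_small M hM w (by positivity) (hp m) (hp0 m)
  choose q hq hq0 hpq hqw using hQ
  set y := auxY q with hy
  have hyM : y ∈ M := auxY_mem M q fun m => (hq m).1
  have hey : e * y ≠ 0 := by
    intro h0
    refine auxY_ne q hx hqw ?_
    have h1 : inner ℂ (star e (y w)) w = inner ℂ (y w) (e w) := by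
      rw [ContinuousLinearMap.star_eq_adjoint, ContinuousLinearMap.adjoint_inner_left]
    rw [hee, he.1.2.1] at h1
    change inner ℂ (y w) w = 0
    rw [← h1]
    have : e (y w) = 0 := congrArg (fun T : H →L[ℂ] H => T w) h0
    rw [this, inner_zero_left]
  set C := ‖e * y‖ with hC
  have hC0 : 0 < C := norm_pos_iff.2 hey
  let X : H →L[ℂ] H := ((C⁻¹ : ℝ) : ℂ) • (e * y)
  have hX1 : ‖X‖ = 1 := by
    simp only [X, norm_smul, Complex.norm_real, norm_inv, Real.norm_eq_abs, abs_of_pos hC0, ← hC]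
    exact inv_mul_cancel₀ hC0.ne'
  have hXJ : X ∈ compactIdeal M := by
    refine subset_closure (Submodule.subset_span ⟨((C⁻¹ : ℝ) : ℂ) • 1, y, e,
      aux_smul_mem M _ (one_mem M), hyM, he, ?_⟩)
    rw [smul_mul_assoc, smul_mul_assoc, one_mul]
  obtain ⟨n, hn⟩ := hcov X hXJ hX1
  have hlt : ‖X - c n‖ < ‖c n‖ := hn.trans_le (hr n)
  have he1 : ∀ z, ‖e z‖ ≤ ‖e‖ * ‖z‖ := e.le_opNorm
  have hbound : ∀ k : ℕ, ‖c n‖ - ‖X - c n‖ ≤ (1 + C⁻¹ * ‖e‖) * (1 / ((k : ℝ) + 1)) := by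
    intro k
    set m := Nat.pair n k with hm
    have hpc' := hpc m
    rw [hm, Nat.unpair_pair, ← hm] at hpc'
    simp only at hpc'
    obtain ⟨v, hv⟩ : ∃ v, q m v ≠ 0 := by
      by_contra! h
      exact hq0 m (ContinuousLinearMap.ext h)
    set z := q m v with hz
    have hqz : q m z = z := congrArg (fun T : H →L[ℂ] H => T v) (hq m).2.2
    have hpz : p m z = z := congrArg (fun T : H →L[ℂ] H => T v) (hpq m)
    have hz0 : 0 < ‖z‖ := norm_pos_iff.2 hv
    have hyq : ‖y * q m‖ ≤ 1 / ((k : ℝ) + 1) := by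
      have h1 : star (q m * y) = y * q m := by rw [star_mul, auxY_star, (hq m).2.1]
      rw [← h1, norm_star]
      refine (auxY_bound q m).trans ?_
      have : (k : ℝ) ≤ m := by exact_mod_cast Nat.right_le_pair n k
      gcongr
    have hyz : ‖y z‖ ≤ 1 / ((k : ℝ) + 1) * ‖z‖ := by
      have := (y * q m).le_of_opNorm_le hyq z
      rwa [mul_apply_eq_comp, hqz] at this
    have hXz : ‖X z‖ ≤ C⁻¹ * ‖e‖ * (1 / ((k : ℝ) + 1)) * ‖z‖ := by
      have h1 : X z = ((C⁻¹ : ℝ) : ℂ) • e (y z) := rfl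
      rw [h1, norm_smul, Complex.norm_real, Real.norm_eq_abs, abs_of_pos (inv_pos.2 hC0)]
      calc C⁻¹ * ‖e (y z)‖ ≤ C⁻¹ * (‖e‖ * (1 / ((k : ℝ) + 1) * ‖z‖)) := by
            gcongr
            exact (he1 _).trans (by gcongr)
        _ = _ := by ring
    have h5 : ‖c n z‖ ≤ ‖X z‖ + ‖X - c n‖ * ‖z‖ := by
      have h6 := (X - c n).le_opNorm z
      have h7 : c n z = X z - (X - c n) z := by simp
      rw [h7]
      exact (norm_sub_le _ _).trans (by linarith)
    have h8 := hpc' z hpz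
    refine le_of_mul_le_mul_right ?_ hz0
    nlinarith
  have ht : Filter.Tendsto (fun k : ℕ => (1 + C⁻¹ * ‖e‖) * (1 / ((k : ℝ) + 1)))
      Filter.atTop (nhds 0) := by
    simpa using (tendsto_one_div_add_atTop_nhds_zero_nat (𝕜 := ℝ)).const_mul (1 + C⁻¹ * ‖e‖)
  have := ge_of_tendsto' ht hbound
  linarith
end
end
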